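/- arXiv:2108.07750 — 2 statements merged into one kernel-verified Lean document; each statement's English description precedes it below -/
import Mathlib

section
/- Let g be of type D_n (n ≥ 4) and let n be an optimal nilradical of a standard parabolic subalgebra. (1) If both β_2 = ε_1 − ε_2 and β_3 = ε_3 + ε_4 belong to K(n), then n has no commutative polarisation. (2) If g is of type D_{2n} and both β_{2n−1} = ε_{2n−1} + ε_{2n} and β_{2n} = ε_{2n−1} − ε_{2n} belong to K(n), then n has no commutative polarisation. -/
/-!  Common background: index of a Lie algebra, commutative polarisations, CP-ideals,
and an axiomatisation of the set-up of the paper: a complex simple Lie algebra with a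
fixed Cartan and Borel subalgebra, its root system, the Kostant cascade together with its
marking, nilradicals of standard parabolic subalgebras, and Heisenberg subalgebras. -/

noncomputable section
attribute [local instance] Classical.propDecidable

open Module

/-- The stabiliser of `ξ ∈ q*` with respect to the coadjoint representation of `q`. -/
def coadjointStab (k L : Type) [Field k] [LieRing L] [LieAlgebra k L]
    (ξ : Module.Dual k L) : Submodule k L where
  carrier := {x | ∀ y, ξ ⁅x, y⁆ = 0}
  add_mem' := by
    intro a b ha hb y
    simp only [add_lie, map_add, ha y, hb y, add_zero]
  zero_mem' := by
    intro y
    simp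
  smul_mem' := by
    intro c a ha y
    simp [smul_lie, ha y]

/-- The index of a Lie algebra: the minimal dimension of a coadjoint stabiliser. -/
def lieIndex (k L : Type) [Field k] [LieRing L] [LieAlgebra k L] : ℕ :=
  sInf {n | ∃ ξ : Module.Dual k L, n = Module.finrank k (coadjointStab k L ξ)}

/-- `b(q) = (dim q + ind q) / 2`. -/
def bHalf (k L : Type) [Field k] [LieRing L] [LieAlgebra k L] : ℚ :=
  ((Module.finrank k L : ℚ) + (lieIndex k L : ℚ)) / 2

/-- A Lie algebra has a commutative polarisation if it has an abelian subalgebra of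
dimension `b(q)`. -/
def HasCP (k L : Type) [Field k] [LieRing L] [LieAlgebra k L] : Prop :=
  ∃ a : LieSubalgebra k L, IsLieAbelian a ∧ (Module.finrank k ↥a : ℚ) = bHalf k L

/-- `a` is a CP-ideal of the nilradical `n` (relative to the Borel subalgebra `b`):
an abelian ideal of `b` contained in `n` whose dimension is `b(n)`. -/
structure IsCPIdeal {k g : Type} [Field k] [LieRing g] [LieAlgebra k g]
    (b n a : LieSubalgebra k g) : Prop where
  le_nil : a ≤ n
  lie_mem : ∀ x ∈ b, ∀ y ∈ a, ⁅x, y⁆ ∈ a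
  abelian : ∀ x ∈ a, ∀ y ∈ a, ⁅x, y⁆ = (0 : g)
  dim_eq : (Module.finrank k ↥a : ℚ) = bHalf k ↥n

/-- A finite subset of a root system is irreducible if it admits no nontrivial
orthogonal decomposition. -/
def IrredSubset {V : Type} (ip : V → V → ℚ) (X : Finset V) : Prop :=
  ∀ Y ⊆ X, Y.Nonempty → (∀ γ ∈ Y, ∀ δ ∈ X, δ ∉ Y → ip γ δ = 0) → Y = X

/-- The set-up of the paper: a finite-dimensional complex simple Lie algebra `g` with a
Cartan subalgebra `H`, root system `R` with positive roots `Rpos` and simple roots `S`,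
highest root `hi`, Weyl-invariant inner product `ip`, coefficients `coeff γ α = [γ : α]`,
the Kostant cascade `K` (each `β ∈ K` being the highest root of an irreducible
subsystem `sub β`, with descendants `children β` the highest roots of the irreducible
components of the orthogonal complement of `β` in `sub β`), the Borel subalgebra
`borel`, the nilradicals `nT T` and parabolics `pT T` for `T ⊆ S`, Heisenberg
subalgebras `hSub β`, and root vectors `e γ`. -/
structure CascadeSetting (g : Type) [LieRing g] [LieAlgebra ℂ g]
    [FiniteDimensional ℂ g] where
  isSimple : LieAlgebra.IsSimple ℂ g
  H : LieSubalgebra ℂ g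
  cartan : H.IsCartanSubalgebra
  rootSp : Module.Dual ℂ H → Submodule ℂ g
  R : Finset (Module.Dual ℂ H)
  Rpos : Finset (Module.Dual ℂ H)
  S : Finset (Module.Dual ℂ H)
  hi : Module.Dual ℂ H
  ip : Module.Dual ℂ H → Module.Dual ℂ H → ℚ
  coeff : Module.Dual ℂ H → Module.Dual ℂ H → ℕ
  K : Finset (Module.Dual ℂ H)
  sub : Module.Dual ℂ H → Finset (Module.Dual ℂ H)
  children : Module.Dual ℂ H → Finset (Module.Dual ℂ H)
  nT : Finset (Module.Dual ℂ H) → LieSubalgebra ℂ g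
  pT : Finset (Module.Dual ℂ H) → LieSubalgebra ℂ g
  hSub : Module.Dual ℂ H → LieSubalgebra ℂ g
  borel : LieSubalgebra ℂ g
  e : Module.Dual ℂ H → g
  /- root-space decomposition data -/
  rootSp_def : ∀ γ, (rootSp γ : Set g) = {x | ∀ h : H, ⁅(h : g), x⁆ = γ h • x}
  mem_R_iff : ∀ γ, γ ∈ R ↔ γ ≠ 0 ∧ rootSp γ ≠ ⊥
  Rpos_subset : Rpos ⊆ R
  mem_Rpos_or : ∀ γ ∈ R, γ ∈ Rpos ∨ -γ ∈ Rpos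
  not_neg_mem : ∀ γ ∈ Rpos, -γ ∉ Rpos
  S_subset : S ⊆ Rpos
  S_indep : LinearIndependent ℂ (fun α : (S : Set (Module.Dual ℂ H)) => (α : Module.Dual ℂ H))
  coeff_spec : ∀ γ ∈ Rpos, γ = ∑ α ∈ S, coeff γ α • α
  ip_symm : ∀ γ δ, ip γ δ = ip δ γ
  ip_pos : ∀ γ ∈ R, 0 < ip γ γ
  hi_mem : hi ∈ Rpos
  hi_highest : ∀ γ ∈ Rpos, ∀ α ∈ S, coeff γ α ≤ coeff hi α
  /- the inductive construction of the Kostant cascade -/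
  hi_mem_K : hi ∈ K
  sub_hi : sub hi = R
  K_subset : K ⊆ Rpos
  sub_subset : ∀ β ∈ K, sub β ⊆ R
  self_mem_sub : ∀ β ∈ K, β ∈ sub β
  sub_highest : ∀ β ∈ K, ∀ γ ∈ sub β, γ ∈ Rpos → ∀ α ∈ S, coeff γ α ≤ coeff β α
  sub_irred : ∀ β ∈ K, IrredSubset ip (sub β)
  children_subset_K : ∀ β ∈ K, children β ⊆ K
  children_sub : ∀ β ∈ K, ∀ β' ∈ children β, sub β' ⊆ sub β
  children_orth : ∀ β ∈ K, ∀ β' ∈ children β, ∀ γ ∈ sub β', ip γ β = 0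
  children_partition : ∀ β ∈ K, ∀ γ ∈ sub β, ip γ β = 0 →
      ∃! β', β' ∈ children β ∧ γ ∈ sub β'
  children_pairwise_orth : ∀ β ∈ K, ∀ β₁ ∈ children β, ∀ β₂ ∈ children β, β₁ ≠ β₂ →
      ∀ γ ∈ sub β₁, ∀ δ ∈ sub β₂, ip γ δ = 0
  K_generated : ∀ β ∈ K, β ≠ hi → ∃ β' ∈ K, β ∈ children β'
  S_cover : ∀ α ∈ S, ∃! β, β ∈ K ∧ α ∈ sub β ∧ 0 < ip α β
  /- Lie-algebra realisations -/
  borel_def : borel.toSubmodule = H.toSubmodule ⊔ ⨆ γ ∈ Rpos, rootSp γ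
  nT_def : ∀ T, T ⊆ S →
      (nT T).toSubmodule =
        ⨆ γ ∈ Rpos.filter (fun γ => ∃ α ∈ T, coeff γ α ≠ 0), rootSp γ
  pT_def : ∀ T, T ⊆ S →
      (pT T).toSubmodule =
        borel.toSubmodule ⊔
          ⨆ γ ∈ Rpos.filter (fun γ => ∀ α ∈ T, coeff γ α = 0), rootSp (-γ)
  hSub_def : ∀ β ∈ K,
      (hSub β).toSubmodule =
        ⨆ γ ∈ (sub β ∩ Rpos).filter (fun γ => 0 < ip γ β), rootSp γ
  e_mem : ∀ γ ∈ R, e γ ∈ rootSp γ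
  e_ne : ∀ γ ∈ R, e γ ≠ 0

namespace CascadeSetting

variable {g : Type} [LieRing g] [LieAlgebra ℂ g] [FiniteDimensional ℂ g]
variable (cs : CascadeSetting g)

/-- The root order on `Δ⁺`: `γ ≼ δ` iff `δ - γ` is a nonnegative integral combination
of simple roots. -/
def rle (γ δ : Module.Dual ℂ cs.H) : Prop :=
  ∃ c : Module.Dual ℂ cs.H → ℕ, δ = γ + ∑ α ∈ cs.S, c α • α

/-- The support of a positive root: the simple roots occurring in it. -/
def supp (γ : Module.Dual ℂ cs.H) : Finset (Module.Dual ℂ cs.H) :=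
  cs.S.filter fun α => cs.coeff γ α ≠ 0

/-- The partial order of the cascade poset: the reflexive-transitive closure of the
"descendant" relation, so that each element of `K` covers exactly its descendants. -/
def cle (x y : Module.Dual ℂ cs.H) : Prop :=
  Relation.ReflTransGen (fun a b => a ∈ cs.children b) x y

/-- The Heisenberg subset `H_β = {γ ∈ Δ⟨β⟩⁺ : (γ, β) > 0}`. -/
def Heis (β : Module.Dual ℂ cs.H) : Finset (Module.Dual ℂ cs.H) :=
  (cs.sub β ∩ cs.Rpos).filter fun γ => 0 < cs.ip γ β

/-- The marking `Φ(β) = Π ∩ H_β`. -/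
def Phi (β : Module.Dual ℂ cs.H) : Finset (Module.Dual ℂ cs.H) :=
  cs.S ∩ cs.Heis β

/-- The set of roots `Δ(n_T)` of the nilradical `n_T`. -/
def nRoots (T : Finset (Module.Dual ℂ cs.H)) : Finset (Module.Dual ℂ cs.H) :=
  cs.Rpos.filter fun γ => ∃ α ∈ T, cs.coeff γ α ≠ 0

/-- `K(n_T) = K ∩ Δ(n_T)`, the cascade elements among the roots of `n_T`. -/
def KT (T : Finset (Module.Dual ℂ cs.H)) : Finset (Module.Dual ℂ cs.H) :=
  cs.K.filter fun β => β ∈ cs.nRoots T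

/-- The optimisation `T̃ = ⋃_{β ∈ K(n_T)} Φ(β)`, so that `ñ_T = n_{T̃}`. -/
def optT (T : Finset (Module.Dual ℂ cs.H)) : Finset (Module.Dual ℂ cs.H) :=
  (cs.KT T).biUnion cs.Phi

/-- The commutative simple roots: those whose coefficient in the highest root is `1`. -/
def Scom : Finset (Module.Dual ℂ cs.H) :=
  cs.S.filter fun α => cs.coeff cs.hi α = 1

/-- An abelian ideal of the Borel subalgebra. -/
def IsAbIdeal (a : LieSubalgebra ℂ g) : Prop :=
  a ≤ cs.borel ∧ (∀ x ∈ cs.borel, ∀ y ∈ a, ⁅x, y⁆ ∈ a) ∧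
    ∀ x ∈ a, ∀ y ∈ a, ⁅x, y⁆ = (0 : g)

/-- A maximal abelian ideal of the Borel subalgebra. -/
def IsMaxAbIdeal (a : LieSubalgebra ℂ g) : Prop :=
  cs.IsAbIdeal a ∧ ∀ a', cs.IsAbIdeal a' → a ≤ a' → a' = a

end CascadeSetting

/-- A cascade setting of type `D_n` (`n ≥ 4`): the roots are realised via the standard
orthonormal functionals `ε_1, …, ε_n`, with `Δ⁺ = {ε_i ± ε_j : i < j}` and highest
root `θ = ε_1 + ε_2`. -/
structure TypeDSetting (g : Type) [LieRing g] [LieAlgebra ℂ g]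
    [FiniteDimensional ℂ g] (n : ℕ) extends CascadeSetting g where
  four_le : 4 ≤ n
  eps : Fin n → Module.Dual ℂ H
  ip_eps : ∀ i j, ip (eps i) (eps j) = if i = j then 1 else 0
  Rpos_eq : Rpos =
    ((Finset.univ.filter fun p : Fin n × Fin n => p.1 < p.2).image
        fun p => eps p.1 - eps p.2) ∪
    ((Finset.univ.filter fun p : Fin n × Fin n => p.1 < p.2).image
        fun p => eps p.1 + eps p.2)
  hi_eq : hi = eps ⟨0, by omega⟩ + eps ⟨1, by omega⟩

section RootSpaces

open LieAlgebra LieAlgebra.IsKilling LieModule LieModule.Weight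

variable {K L : Type*} [Field K] [CharZero K] [LieRing L] [LieAlgebra K L] [IsKilling K L]
  [FiniteDimensional K L] {H : LieSubalgebra K L} [H.IsCartanSubalgebra]
  [IsTriangularizable K H L]

/-- Root vectors have nonzero bracket whenever the sum of the roots is a root. -/
lemma lie_ne_zero_of_rootSpace_add_ne_bot {α β : Weight K H L} (hα : α.IsNonZero)
    (hβ : β.IsNonZero)
    (hαβ : rootSpace H (α + β : H → K) ≠ ⊥) {x y : L} (hx : x ∈ rootSpace H α) (hx0 : x ≠ 0)
    (hy : y ∈ rootSpace H β) (hy0 : y ≠ 0) : ⁅x, y⁆ ≠ 0 := by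
  obtain ⟨h, e, f, isSl2, he, hf⟩ := exists_isSl2Triple_of_weight_isNonZero hα
  obtain rfl := isSl2.h_eq_coroot hα he hf
  obtain ⟨z, hz, z_ne0⟩ := (chainTop α β).exists_ne_zero
  have prim : isSl2.HasPrimitiveVectorWith z (chainLength α β : K) :=
    have := lie_mem_genWeightSpace_of_mem_genWeightSpace he hz
    ⟨z_ne0, (chainLength_smul _ _ hz).symm, by rwa [genWeightSpace_add_chainTop _ _ hα] at this⟩
  have ht : 1 ≤ chainTopCoeff α β := by
    have := (rootSpace_zsmul_add_ne_bot_iff α β hα 1).1 (by simpa using hαβ)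
    exact_mod_cast this.1
  obtain ⟨t, ht'⟩ : ∃ t, chainTopCoeff α β = t + 1 := ⟨_, (Nat.sub_add_cancel ht).symm⟩
  have hle : t + 1 ≤ chainLength α β := ht' ▸ chainTopCoeff_le_chainLength α β
  set w := ((toEnd K L L f) ^ (t + 1)) z with hw
  have hw0 : w ≠ 0 := prim.pow_toEnd_f_ne_zero_of_eq_nat rfl hle
  have hwβ : w ∈ rootSpace H β := by
    have := toEnd_pow_apply_mem hf hz (t + 1)
    convert this using 2
    rw [coe_chainTop', ht']
    simp
  have key := prim.lie_e_pow_succ_toEnd_f t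
  have hne : ⁅e, w⁆ ≠ 0 := by
    rw [hw, key]
    refine smul_ne_zero (mul_ne_zero (Nat.cast_add_one_ne_zero t) ?_)
      (prim.pow_toEnd_f_ne_zero_of_eq_nat rfl (by omega))
    rw [sub_ne_zero]
    exact_mod_cast (by omega : chainLength α β ≠ t)
  obtain ⟨c, rfl⟩ : ∃ c : K, c • x = e := by
    simpa using (finrank_eq_one_iff_of_nonzero' ⟨x, hx⟩ (by simpa using hx0)).mp
      (finrank_rootSpace_eq_one _ hα) ⟨e, he⟩
  obtain ⟨d, hd⟩ : ∃ d : K, d • y = w := by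
    simpa using (finrank_eq_one_iff_of_nonzero' ⟨y, hy⟩ (by simpa using hy0)).mp
      (finrank_rootSpace_eq_one _ hβ) ⟨w, hwβ⟩
  intro h0
  simp [← hd, h0] at hne

end RootSpaces

/-- A positive definite form on the lattice generated by a crystallographic reduced set of
roots. -/
structure IsRootForm {V : Type*} [AddCommGroup V] (R : Set V) (b : V → V → ℝ) : Prop where
  add_left : ∀ x y z, b (x + y) z = b x z + b y z
  symm : ∀ x y, b x y = b y x
  pos : ∀ x ∈ AddSubgroup.closure R, x ≠ 0 → 0 < b x x
  reflection : ∀ α ∈ R, ∀ β ∈ R, ∃ z : ℤ, 2 * b α β = z * b α α ∧ β - z • α ∈ R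
  sub_mem : ∀ α ∈ R, ∀ β ∈ R, 0 < b α β → α ≠ β → β - α ∈ R
  neg_mem : ∀ α ∈ R, -α ∈ R
  zero_notMem : (0 : V) ∉ R
  add_self_notMem : ∀ α ∈ R, α + α ∉ R

/-- Root vectors `e γ`, `γ ∈ R`, of a Lie algebra. -/
structure IsRootVectors {V L : Type*} [AddCommGroup V] [LieRing L] [LieAlgebra ℂ L]
    (R : Set V) (e : V → L) : Prop where
  indep : LinearIndepOn ℂ e R
  lie_mem : ∀ α ∈ R, ∀ β ∈ R, α + β ∈ R → ∃ c : ℂ, c ≠ 0 ∧ ⁅e α, e β⁆ = c • e (α + β)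
  lie_zero : ∀ α ∈ R, ∀ β ∈ R, α + β ∉ R → α + β ≠ 0 → ⁅e α, e β⁆ = 0

namespace RootPairing

variable {ι M N : Type*} [Fintype ι] [AddCommGroup M] [Module ℂ M] [AddCommGroup N] [Module ℂ N]
  (P : RootPairing ι ℂ M N) [P.IsCrystallographic] [P.IsReduced]

lemma exists_isRootForm [P.IsRootSystem] : ∃ b : M → M → ℝ, IsRootForm (Set.range P.root) b := by
  have hsymm (x y : M) : (P.RootForm x y).re = (P.RootForm y x).re := by
    simpa using congrArg Complex.re (P.rootForm_symmetric.eq x y)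
  have hpr (i j : ι) : 2 * (P.RootForm (P.root i) (P.root j)).re =
      (P.pairingIn ℤ i j : ℝ) * (P.RootForm (P.root j) (P.root j)).re := by
    have := congrArg Complex.re (P.toInvariantForm.two_mul_apply_root_root i j)
    rw [← P.algebraMap_pairingIn ℤ] at this
    simpa using this
  have hpos : ∀ x ∈ AddSubgroup.closure (Set.range P.root), x ≠ 0 → 0 < (P.RootForm x x).re := by
    intro x hx h0
    have hz (i : ι) : ∃ z : ℤ, P.coroot' i x = z := by
      clear h0
      induction hx using AddSubgroup.closure_induction with
      | mem x hx =>
        obtain ⟨j, rfl⟩ := hx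
        exact ⟨P.pairingIn ℤ j i, by simpa using (P.algebraMap_pairingIn ℤ j i).symm⟩
      | zero => exact ⟨0, by simp⟩
      | add x y _ _ hx hy =>
        obtain ⟨a, ha⟩ := hx
        obtain ⟨b, hb⟩ := hy
        exact ⟨a + b, by rw [map_add, ha, hb, Int.cast_add]⟩
      | neg x _ hx =>
        obtain ⟨a, ha⟩ := hx
        exact ⟨-a, by rw [map_neg, ha, Int.cast_neg]⟩
    choose z hz using hz
    have hsum : (P.RootForm x x).re = ∑ i, (z i : ℝ) * z i := by
      simp [P.rootForm_apply_apply, hz]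
    rw [hsum]
    refine (Finset.sum_nonneg fun i _ => mul_self_nonneg _).lt_of_ne' fun h => h0 ?_
    have h' := (Finset.sum_eq_zero_iff_of_nonneg fun i _ => mul_self_nonneg ((z i : ℤ) : ℝ)).1 h
    refine P.rootForm_nondegenerate.1 x fun y => ?_
    rw [P.rootForm_apply_apply]
    refine Finset.sum_eq_zero fun i hi => ?_
    have := h' i hi
    simp_all
  refine ⟨fun x y => (P.RootForm x y).re, ?_, hsymm, hpos, ?_, ?_, ?_, ?_, ?_⟩
  · intro x y z; simp
  · rintro _ ⟨i, rfl⟩ _ ⟨j, rfl⟩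
    refine ⟨P.pairingIn ℤ j i, by rw [← hpr, hsymm], P.reflectionPerm i j, ?_⟩
    rw [P.root_reflectionPerm, P.reflection_apply_root, ← P.algebraMap_pairingIn ℤ]
    simp [Int.cast_smul_eq_zsmul]
  · rintro _ ⟨i, rfl⟩ _ ⟨j, rfl⟩ hp hne
    refine P.root_sub_root_mem_of_pairingIn_pos ?_ (by rintro rfl; exact hne rfl)
    have hi := hpos _ (AddSubgroup.subset_closure ⟨i, rfl⟩) (P.ne_zero i)
    have := hpr j i
    rw [hsymm] at this
    have : (0 : ℝ) < P.pairingIn ℤ j i := by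
      by_contra! h
      nlinarith
    exact_mod_cast this
  · rintro _ ⟨i, rfl⟩
    exact ⟨P.reflectionPerm i i, by simp⟩
  · rintro ⟨i, hi⟩
    exact P.ne_zero i hi
  · rintro _ ⟨i, rfl⟩ hj
    have : IsAddTorsionFree M := .of_isTorsionFree ℂ M
    exact P.nsmul_notMem_range_root (n := 2) (by rwa [two_nsmul])

end RootPairing

namespace CascadeSetting

open LieAlgebra LieAlgebra.IsKilling LieModule

variable {g : Type} [LieRing g] [LieAlgebra ℂ g] [FiniteDimensional ℂ g]
variable (cs : CascadeSetting g)

lemma exists_rootForm_rootVectors :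
    (∃ b, IsRootForm (cs.R : Set (Dual ℂ cs.H)) b) ∧
    IsRootVectors (cs.R : Set (Dual ℂ cs.H)) cs.e ∧
    ∀ γ ∈ cs.R, cs.rootSp γ = Submodule.span ℂ {cs.e γ} := by
  have := cs.isSimple
  have := cs.cartan
  have hsp (γ : Dual ℂ cs.H) : cs.rootSp γ = (rootSpace cs.H γ).toSubmodule := by
    ext x
    have : x ∈ cs.rootSp γ ↔ ∀ h : cs.H, ⁅(h : g), x⁆ = γ h • x := by
      rw [← SetLike.mem_coe, cs.rootSp_def]; rfl
    rw [this]
    constructor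
    · intro h
      refine weightSpace_le_genWeightSpace g _ ?_
      exact (mem_weightSpace _ _).2 h
    · intro h y
      exact lie_eq_smul_of_mem_rootSpace h y
  have hR (γ : Dual ℂ cs.H) : γ ∈ cs.R ↔ γ ∈ Set.range (rootSystem cs.H).root := by
    rw [cs.mem_R_iff, hsp]
    constructor
    · rintro ⟨h0, h1⟩
      have h1 : rootSpace cs.H γ ≠ ⊥ := by simpa using h1
      have hn : (⟨γ, h1⟩ : Weight ℂ cs.H g).IsNonZero := fun h => h0 <| by
        ext x
        exact congrFun h x
      exact ⟨⟨⟨γ, h1⟩, by simpa using hn⟩, by ext; simp⟩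
    · rintro ⟨i, rfl⟩
      refine ⟨(rootSystem cs.H).ne_zero i, ?_⟩
      exact fun h => i.1.2 ((LieSubmodule.toSubmodule_eq_bot _).1 h)
  have hR' : (cs.R : Set (Dual ℂ cs.H)) = Set.range (rootSystem cs.H).root :=
    Set.ext fun γ => hR γ
  have hwt : ∀ γ ∈ cs.R, ∃ α : Weight ℂ cs.H g, α.IsNonZero ∧ (α : cs.H → ℂ) = γ := by
    intro γ hγ
    obtain ⟨i, rfl⟩ := (hR γ).1 hγ
    exact ⟨i, (Finset.mem_filter.1 i.2).2, by ext; simp⟩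
  have hmem : ∀ γ ∈ cs.R, cs.e γ ∈ rootSpace cs.H γ := by
    intro γ hγ
    simpa [hsp] using cs.e_mem γ hγ
  refine ⟨hR' ▸ (rootSystem cs.H).exists_isRootForm, ⟨?_, ?_, ?_⟩, ?_⟩
  · have hind : iSupIndep fun γ : (cs.R : Set (Dual ℂ cs.H)) =>
        (rootSpace cs.H (γ : cs.H → ℂ)).toSubmodule := by
      have := (LieSubmodule.iSupIndep_toSubmodule.2 (iSupIndep_genWeightSpace ℂ cs.H g)).comp
        (f := fun γ : (cs.R : Set (Dual ℂ cs.H)) => ((γ : Dual ℂ cs.H) : cs.H → ℂ))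
        fun _ _ h => Subtype.ext (DFunLike.coe_injective h)
      exact this
    exact hind.linearIndependent _ (fun γ => hmem γ γ.2) fun γ => cs.e_ne γ γ.2
  · intro α hα β hβ hαβ
    obtain ⟨a, ha0, ha⟩ := hwt α hα
    obtain ⟨b, hb0, hb⟩ := hwt β hβ
    obtain ⟨c, hc0, hc⟩ := hwt _ hαβ
    have hab : rootSpace cs.H (a + b : cs.H → ℂ) ≠ ⊥ := by
      rw [ha, hb]
      have hc2 : rootSpace cs.H c ≠ ⊥ := c.2
      rwa [hc] at hc2
    have hne := lie_ne_zero_of_rootSpace_add_ne_bot ha0 hb0 hab (ha ▸ hmem α hα) (cs.e_ne α hα)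
      (hb ▸ hmem β hβ) (cs.e_ne β hβ)
    have hl : ⁅cs.e α, cs.e β⁆ ∈ rootSpace cs.H c := by
      rw [hc]
      exact lie_mem_genWeightSpace_of_mem_genWeightSpace (hmem α hα) (hmem β hβ)
    obtain ⟨t, ht⟩ : ∃ t : ℂ, t • cs.e (α + β) = ⁅cs.e α, cs.e β⁆ := by
      simpa using (finrank_eq_one_iff_of_nonzero' ⟨cs.e (α + β), hc ▸ hmem _ hαβ⟩
        (by simpa using cs.e_ne _ hαβ)).mp (finrank_rootSpace_eq_one c hc0) ⟨_, hl⟩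
    refine ⟨t, ?_, ht.symm⟩
    rintro rfl
    exact hne (by rw [← ht, zero_smul])
  · intro α hα β hβ hαβ h0
    have hl : ⁅cs.e α, cs.e β⁆ ∈ rootSpace cs.H ((α + β : Dual ℂ cs.H) : cs.H → ℂ) :=
      lie_mem_genWeightSpace_of_mem_genWeightSpace (hmem α hα) (hmem β hβ)
    have : rootSpace cs.H ((α + β : Dual ℂ cs.H) : cs.H → ℂ) = ⊥ := by
      by_contra h
      exact hαβ ((cs.mem_R_iff _).2 ⟨h0, by simpa [hsp] using h⟩)
    exact (LieSubmodule.mem_bot _).1 (this ▸ hl)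
  · intro γ hγ
    obtain ⟨a, ha0, ha⟩ := hwt γ hγ
    rw [hsp, ← ha]
    refine (Submodule.eq_of_le_of_finrank_eq ?_ ?_).symm
    · rw [Submodule.span_singleton_le_iff_mem]
      simpa [ha] using hmem γ hγ
    · rw [finrank_span_singleton (cs.e_ne γ hγ)]
      exact (finrank_rootSpace_eq_one a ha0).symm

end CascadeSetting

section Stabilizer

variable {L : Type*} [LieRing L] [LieAlgebra ℂ L]

/-- The radical of the form `ξ ⁅x, y⁆` restricted to a subspace. -/
def stabOn (ξ : Dual ℂ L) (W : Submodule ℂ L) : Submodule ℂ L where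
  carrier := {x | x ∈ W ∧ ∀ y ∈ W, ξ ⁅x, y⁆ = 0}
  add_mem' := fun ⟨ha, ha'⟩ ⟨hb, hb'⟩ =>
    ⟨W.add_mem ha hb, fun y hy => by simp [ha' y hy, hb' y hy]⟩
  zero_mem' := ⟨W.zero_mem, by simp⟩
  smul_mem' := fun c _ ⟨ha, ha'⟩ => ⟨W.smul_mem c ha, fun y hy => by simp [ha' y hy]⟩

lemma mem_stabOn {ξ : Dual ℂ L} {W : Submodule ℂ L} {x : L} :
    x ∈ stabOn ξ W ↔ x ∈ W ∧ ∀ y ∈ W, ξ ⁅x, y⁆ = 0 := Iff.rfl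

/-- The form `ξ ⁅x, y⁆` on a subspace, as a map to the dual. -/
def lieForm (ξ : Dual ℂ L) (W : Submodule ℂ L) : W →ₗ[ℂ] Dual ℂ W :=
  LinearMap.mk₂ ℂ (fun x y => ξ ⁅(x : L), (y : L)⁆) (by simp) (by simp) (by simp) (by simp)

lemma lieForm_apply (ξ : Dual ℂ L) (W : Submodule ℂ L) (x y : W) :
    lieForm ξ W x y = ξ ⁅(x : L), (y : L)⁆ := rfl

lemma map_ker_lieForm (ξ : Dual ℂ L) (W : Submodule ℂ L) :
    (LinearMap.ker (lieForm ξ W)).map W.subtype = stabOn ξ W := by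
  ext x
  simp only [Submodule.mem_map, LinearMap.mem_ker, Submodule.coe_subtype, mem_stabOn]
  constructor
  · rintro ⟨x, hx, rfl⟩
    exact ⟨x.2, fun y hy => by simpa [lieForm_apply] using congrArg (· ⟨y, hy⟩) hx⟩
  · rintro ⟨hx, h⟩
    exact ⟨⟨x, hx⟩, by ext y; simpa [lieForm_apply] using h y y.2, rfl⟩

lemma finrank_stabOn (ξ : Dual ℂ L) (W : Submodule ℂ L) :
    finrank ℂ (stabOn ξ W) = finrank ℂ (LinearMap.ker (lieForm ξ W)) := by
  rw [← map_ker_lieForm]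
  exact (LinearEquiv.finrank_eq (Submodule.equivSubtypeMap W _)).symm

/-- The dimension bound for isotropic subspaces. -/
lemma two_mul_finrank_le_of_isotropic {ξ : Dual ℂ L} {A W : Submodule ℂ L}
    [FiniteDimensional ℂ W] (hA : A ≤ W) (h : ∀ x ∈ A, ∀ y ∈ A, ξ ⁅x, y⁆ = 0) :
    2 * finrank ℂ A ≤ finrank ℂ W + finrank ℂ (stabOn ξ W) := by
  set A' := A.comap W.subtype with hA'
  have hfA : finrank ℂ A' = finrank ℂ A :=
    (Submodule.comapSubtypeEquivOfLe hA).finrank_eq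
  have hrk := LinearMap.finrank_range_add_finrank_ker ((lieForm ξ W).domRestrict A')
  have hr : LinearMap.range ((lieForm ξ W).domRestrict A') ≤ A'.dualAnnihilator := by
    rintro _ ⟨x, rfl⟩
    rw [Submodule.mem_dualAnnihilator]
    exact fun y hy => h _ x.2 _ hy
  have hr' := Submodule.finrank_mono hr
  have hann := Subspace.finrank_add_finrank_dualAnnihilator_eq A'
  have hk : finrank ℂ (LinearMap.ker ((lieForm ξ W).domRestrict A')) ≤
      finrank ℂ (LinearMap.ker (lieForm ξ W)) := by
    refine LinearMap.finrank_le_finrank_of_injective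
      (f := (A'.subtype.domRestrict _).codRestrict _ fun x => ?_) ?_
    · have := x.2
      rw [LinearMap.mem_ker] at this ⊢
      exact this
    · intro x y hxy
      have hval : (x : W) = (y : W) := 
        congrArg (fun w : LinearMap.ker (lieForm ξ W) => (w : W)) hxy
      exact Subtype.ext (Subtype.ext hval)
  rw [finrank_stabOn]
  omega

lemma exists_finrank_ker_add_smul_le {W U : Type*} [AddCommGroup W] [Module ℂ W]
    [AddCommGroup U] [Module ℂ U] [FiniteDimensional ℂ W] (A B : W →ₗ[ℂ] U) :
    ∃ t : ℂ, t ≠ 0 ∧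
      finrank ℂ (LinearMap.ker (A + t • B)) ≤ finrank ℂ (LinearMap.ker A) := by
  obtain ⟨C, hC⟩ := (LinearMap.ker A).exists_isCompl
  obtain ⟨g, hg⟩ := (A.domRestrict C).exists_leftInverse_of_injective <| by
    rw [LinearMap.ker_eq_bot']
    intro x hx
    have : (x : W) ∈ LinearMap.ker A ⊓ C := ⟨hx, x.2⟩
    rw [hC.inf_eq_bot] at this
    simpa using this
  obtain ⟨s, hs⟩ := ((End.finite_hasEigenvalue (g ∘ₗ B.domRestrict C)).union
    (Set.finite_singleton 0)).infinite_compl.nonempty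
  simp only [Set.mem_compl_iff, Set.mem_union, Set.mem_singleton_iff, not_or] at hs
  refine ⟨-s⁻¹, by simpa using hs.2, ?_⟩
  have hdis : Disjoint (LinearMap.ker (A + (-s⁻¹) • B)) C := by
    rw [Submodule.disjoint_def]
    intro x hx hxC
    by_contra h0
    refine hs.1 (End.hasEigenvalue_of_hasEigenvector (x := ⟨x, hxC⟩)
      ⟨End.mem_eigenspace_iff.2 ?_, by simpa using h0⟩)
    have h1 : A x = s⁻¹ • B x := by
      simpa [add_eq_zero_iff_eq_neg] using hx
    have h2 : g (A x) = ⟨x, hxC⟩ := LinearMap.congr_fun hg ⟨x, hxC⟩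
    have h3 : B x = s • A x := by rw [h1, smul_smul, mul_inv_cancel₀ hs.2, one_smul]
    simp [h3, h2]
  have h1 := Submodule.finrank_add_finrank_le_of_disjoint hdis
  have h2 := Submodule.finrank_add_eq_of_isCompl hC
  omega

lemma exists_finrank_stabOn_le (ξ η : Dual ℂ L) (W : Submodule ℂ L) [FiniteDimensional ℂ W] :
    ∃ t : ℂ, t ≠ 0 ∧ finrank ℂ (stabOn (ξ + t • η) W) ≤ finrank ℂ (stabOn ξ W) := by
  obtain ⟨t, ht, h⟩ := exists_finrank_ker_add_smul_le (lieForm ξ W) (lieForm η W)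
  refine ⟨t, ht, ?_⟩
  have hadd : lieForm (ξ + t • η) W = lieForm ξ W + t • lieForm η W := by
    ext x y
    simp [lieForm_apply]
  rwa [finrank_stabOn, finrank_stabOn, hadd]

/-- Reduction of a stabiliser along a Heisenberg-type decomposition `Z ⊕ U ⊕ ℂ c`. -/
lemma finrank_stabOn_add_le {ξ : Dual ℂ L} {W Z U U' U₀ : Submodule ℂ L} {c u : L}
    [FiniteDimensional ℂ W] [FiniteDimensional ℂ Z]
    (hW : W = Z ⊔ U' ⊔ Submodule.span ℂ {c}) (hU : U' ≤ U) (hU₀ : U₀ ≤ U')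
    (hc : ∀ x ∈ Z ⊔ U, ⁅c, x⁆ = 0)
    (hUU : ∀ x ∈ U, ∀ y ∈ U, ⁅x, y⁆ ∈ Submodule.span ℂ {c})
    (hUZ : ∀ x ∈ U, ∀ z ∈ Z, ⁅x, z⁆ ∈ U')
    (h₀ : ∀ x ∈ U₀, ∀ y ∈ Z ⊔ U', ξ ⁅x, y⁆ = 0)
    (hu : u ∈ U) (hξ : ∀ v ∈ U, ξ ⁅u, v⁆ = ξ v)
    (hind : ∀ z ∈ Z, ∀ v ∈ U, ∀ t : ℂ, z + v + t • c = 0 → z = 0 ∧ v = 0 ∧ t = 0) :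
    ∃ ξ' : Dual ℂ L,
      finrank ℂ (stabOn ξ' Z) + finrank ℂ U₀ + 1 ≤ finrank ℂ (stabOn ξ W) := by
  have hcl (a : L) (ha : a ∈ Submodule.span ℂ {c}) (x : L) (hx : x ∈ Z ⊔ U) : ⁅a, x⁆ = 0 := by
    obtain ⟨t, rfl⟩ := Submodule.mem_span_singleton.1 ha
    rw [smul_lie, hc x hx, smul_zero]
  have hcr (a : L) (ha : a ∈ Submodule.span ℂ {c}) (x : L) (hx : x ∈ Z ⊔ U) : ⁅x, a⁆ = 0 := by
    rw [← lie_skew, hcl a ha x hx, neg_zero]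
  have hZ : Z ≤ Z ⊔ U := le_sup_left
  have hU1 : U ≤ Z ⊔ U := le_sup_right
  have hUZ' : ∀ x ∈ U, ∀ z ∈ Z, ⁅z, x⁆ ∈ U' := fun x hx z hz => by
    rw [← lie_skew]; exact U'.neg_mem (hUZ x hx z hz)
  have hwl {v z : L} (hv : v ∈ U) (hz : z ∈ Z) : ξ ⁅v, z⁆ = ξ ⁅v, ⁅u, z⁆⁆ := by
    rw [← hξ _ (hU (hUZ v hv z hz)), leibniz_lie, hcl _ (hUU u hu v hv) z (hZ hz), zero_add]
  have hlw {v z : L} (hv : v ∈ U) (hz : z ∈ Z) : ξ ⁅z, v⁆ = ξ ⁅⁅u, z⁆, v⁆ := by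
    rw [← hξ _ (hU (hUZ' v hv z hz)), leibniz_lie, hcr _ (hUU u hu v hv) z (hZ hz), add_zero]
  let ξ' : Dual ℂ L := ξ - (1 / 2 : ℂ) • (ξ ∘ₗ (LieAlgebra.ad ℂ L u : L →ₗ[ℂ] L))
  have hξ' {z₁ z₂ : L} (h1 : z₁ ∈ Z) (h2 : z₂ ∈ Z) :
      ξ' ⁅z₁, z₂⁆ = ξ ⁅z₁ - ⁅u, z₁⁆, z₂⁆ := by
    have h3 := hwl (hU (hUZ u hu z₁ h1)) h2
    have h4 := hlw (hU (hUZ u hu z₂ h2)) h1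
    simp only [ξ', LinearMap.sub_apply, LinearMap.smul_apply, LinearMap.comp_apply,
      LieAlgebra.ad_apply, leibniz_lie u z₁ z₂, map_add, sub_lie, map_sub, h4, ← h3, smul_eq_mul]
    ring
  refine ⟨ξ', ?_⟩
  let F : (stabOn ξ' Z × U₀) × ℂ →ₗ[ℂ] L :=
    LinearMap.coprod (LinearMap.coprod
      ((LinearMap.id - (LieAlgebra.ad ℂ L u : L →ₗ[ℂ] L)) ∘ₗ (stabOn ξ' Z).subtype) U₀.subtype)
      (LinearMap.toSpanSingleton ℂ L c)
  have hF (z : stabOn ξ' Z) (v : U₀) (t : ℂ) : F ((z, v), t) = (z - ⁅u, (z : L)⁆) + v + t • c := by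
    simp [F]
  have hcW : c ∈ W := hW ▸ Submodule.mem_sup_right (Submodule.mem_span_singleton_self c)
  have hZW : Z ≤ W := hW ▸ le_sup_left.trans le_sup_left
  have hUW : U' ≤ W := hW ▸ le_sup_right.trans le_sup_left
  have hinj : Function.Injective F := by
    rw [injective_iff_map_eq_zero]
    rintro ⟨⟨z, v⟩, t⟩ h
    rw [hF] at h
    obtain ⟨h1, h2, h3⟩ := hind z z.2.1 (v - ⁅u, (z : L)⁆)
      (U.sub_mem (hU (hU₀ v.2)) (hU (hUZ u hu z z.2.1))) t (by rw [← h]; abel)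
    simp only [h1, lie_zero, sub_zero] at h2
    simp only [Prod.mk_eq_zero]
    exact ⟨⟨Subtype.ext h1, Subtype.ext h2⟩, h3⟩
  have hmem (x) : F x ∈ stabOn ξ W := by
    obtain ⟨⟨z, v⟩, t⟩ := x
    rw [hF]
    have hz := z.2.1
    refine ⟨W.add_mem (W.add_mem (W.sub_mem (hZW hz) (hUW (hUZ u hu _ hz)))
      (hUW (hU₀ v.2))) (W.smul_mem t hcW), ?_⟩
    have hx1 : (z - ⁅u, (z : L)⁆) + v ∈ Z ⊔ U :=
      Submodule.add_mem _ (Submodule.sub_mem _ (hZ hz) (hU1 (hU (hUZ u hu _ hz))))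
        (hU1 (hU (hU₀ v.2)))
    intro y hy
    rw [hW] at hy
    obtain ⟨y', hy', d, hd, rfl⟩ := Submodule.mem_sup.1 hy
    obtain ⟨a, ha, b, hb, rfl⟩ := Submodule.mem_sup.1 hy'
    have hcc : ⁅c, d⁆ = 0 := by
      obtain ⟨s, rfl⟩ := Submodule.mem_span_singleton.1 hd
      simp
    have e1 := hξ' hz ha
    rw [z.2.2 a ha, sub_lie, map_sub] at e1
    have e2 := hlw (hU hb) hz
    have e3 := h₀ v v.2 _ hy'
    have hab : a + b ∈ Z ⊔ U := Submodule.add_mem _ (hZ ha) (hU1 (hU hb))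
    rw [lie_add, add_lie _ (t • c) d, hcr d hd _ hx1, smul_lie, hcc, smul_zero, add_zero, add_zero,
      add_lie _ (t • c), smul_lie, hc _ hab, smul_zero, add_zero, add_lie, map_add, e3, add_zero,
      sub_lie, lie_add, lie_add, map_sub, map_add, map_add]
    linear_combination -e1 + e2
  have : FiniteDimensional ℂ (stabOn ξ W) :=
    Submodule.finiteDimensional_of_le (S₂ := W) fun x hx => hx.1
  have : FiniteDimensional ℂ (stabOn ξ' Z) :=
    Submodule.finiteDimensional_of_le (S₂ := Z) fun x hx => hx.1
  have : FiniteDimensional ℂ U₀ := Submodule.finiteDimensional_of_le (hU₀.trans hUW)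
  have := LinearMap.finrank_le_finrank_of_injective (f := F.codRestrict _ hmem)
    fun x y hxy => hinj (congrArg Subtype.val hxy)
  simpa [Module.finrank_prod] using this

end Stabilizer

section Polarisation

variable {V L : Type*} [AddCommGroup V] [LieRing L] [LieAlgebra ℂ L]

/-- A commutative set of roots `C` whose size reaches the bound for isotropic subspaces of the
span of the root vectors from `Q`. -/
structure IsCommPol (R : Set V) (e : V → L) (C Q : Finset V) : Prop where
  subset : C ⊆ Q
  comm : ∀ γ ∈ C, ∀ δ ∈ C, γ + δ ∉ R
  le : ∃ ξ : Dual ℂ L, Q.card + finrank ℂ (stabOn ξ (Submodule.span ℂ (e '' Q))) ≤ 2 * C.card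

variable {R : Set V} {e : V → L} {C Q : Finset V}

lemma IsRootVectors.finrank_span (he : IsRootVectors R e) (hQ : (Q : Set V) ⊆ R) :
    finrank ℂ (Submodule.span ℂ (e '' Q)) = Q.card := by
  rw [Set.image_eq_range, finrank_span_eq_card (he.indep.mono hQ)]
  simp

instance (Q : Finset V) : FiniteDimensional ℂ (Submodule.span ℂ (e '' Q)) :=
  FiniteDimensional.span_of_finite ℂ (Q.finite_toSet.image e)

lemma lie_eq_zero_of_mem_span {X Y : Set L} (h : ∀ x ∈ X, ∀ y ∈ Y, ⁅x, y⁆ = 0) :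
    ∀ x ∈ Submodule.span ℂ X, ∀ y ∈ Submodule.span ℂ Y, ⁅x, y⁆ = 0 := by
  intro x hx y hy
  induction hx, hy using Submodule.span_induction₂ with
  | mem_mem x y hx hy => exact h x hx y hy
  | zero_left => simp
  | zero_right => simp
  | add_left x y z _ _ _ h1 h2 => rw [add_lie, h1, h2, add_zero]
  | add_right x y z _ _ _ h1 h2 => rw [lie_add, h1, h2, add_zero]
  | smul_left r x y _ _ h => rw [smul_lie, h, smul_zero]
  | smul_right r x y _ _ h => rw [lie_smul, h, smul_zero]

lemma lie_mem_of_mem_span {X Y : Set L} {W : Submodule ℂ L} (h : ∀ x ∈ X, ∀ y ∈ Y, ⁅x, y⁆ ∈ W) :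
    ∀ x ∈ Submodule.span ℂ X, ∀ y ∈ Submodule.span ℂ Y, ⁅x, y⁆ ∈ W := by
  intro x hx y hy
  induction hx, hy using Submodule.span_induction₂ with
  | mem_mem x y hx hy => exact h x hx y hy
  | zero_left => simp
  | zero_right => simp
  | add_left x y z _ _ _ h1 h2 => rw [add_lie]; exact W.add_mem h1 h2
  | add_right x y z _ _ _ h1 h2 => rw [lie_add]; exact W.add_mem h1 h2
  | smul_left r x y _ _ h => rw [smul_lie]; exact W.smul_mem r h
  | smul_right r x y _ _ h => rw [lie_smul]; exact W.smul_mem r h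

lemma IsRootVectors.two_mul_card_le (he : IsRootVectors R e) (hQ : (Q : Set V) ⊆ R)
    (hC : C ⊆ Q) (hcomm : ∀ γ ∈ C, ∀ δ ∈ C, γ + δ ∉ R)
    (h0 : ∀ γ ∈ Q, ∀ δ ∈ Q, γ + δ ≠ 0) (ξ : Dual ℂ L) :
    2 * C.card ≤ Q.card + finrank ℂ (stabOn ξ (Submodule.span ℂ (e '' Q))) := by
  rw [← he.finrank_span hQ,
    ← he.finrank_span ((Finset.coe_subset.2 hC).trans hQ)]
  refine two_mul_finrank_le_of_isotropic (Submodule.span_mono (Set.image_mono hC)) ?_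
  intro x hx y hy
  rw [lie_eq_zero_of_mem_span ?_ x hx y hy, map_zero]
  rintro _ ⟨γ, hγ, rfl⟩ _ ⟨δ, hδ, rfl⟩
  exact he.lie_zero γ (hQ (hC hγ)) δ (hQ (hC hδ)) (hcomm γ hγ δ hδ) (h0 γ (hC hγ) δ (hC hδ))

/-- A commutative polarisation contains every root which commutes with it. -/
lemma IsCommPol.mem_of_central (h : IsCommPol R e C Q) (he : IsRootVectors R e)
    (hQ : (Q : Set V) ⊆ R) (h0 : ∀ γ ∈ Q, ∀ δ ∈ Q, γ + δ ≠ 0) {β : V} (hβ : β ∈ Q)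
    (hβ2 : β + β ∉ R) (hβC : ∀ γ ∈ C, β + γ ∉ R) : β ∈ C := by
  by_contra hn
  obtain ⟨ξ, hξ⟩ := h.le
  have := he.two_mul_card_le hQ (C := insert β C) (Finset.insert_subset hβ h.subset) ?_ h0 ξ
  · rw [Finset.card_insert_of_notMem hn] at this
    omega
  · intro γ hγ δ hδ
    rw [Finset.mem_insert] at hγ hδ
    rcases hγ with rfl | hγ <;> rcases hδ with rfl | hδ
    · exact hβ2
    · exact hβC δ hδ
    · rw [add_comm]; exact hβC γ hγ
    · exact h.comm γ hγ δ hδ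

end Polarisation

section Polarisation

variable {V L : Type*} [AddCommGroup V] [LieRing L] [LieAlgebra ℂ L]
  {R : Set V} {e : V → L} {C Q : Finset V}

lemma IsRootVectors.lie_mem_span (he : IsRootVectors R e) {A B D : Set V} (hA : A ⊆ R) (hB : B ⊆ R)
    (h : ∀ γ ∈ A, ∀ δ ∈ B, γ + δ ∈ R → γ + δ ∈ D) (h0 : ∀ γ ∈ A, ∀ δ ∈ B, γ + δ ≠ 0) :
    ∀ x ∈ Submodule.span ℂ (e '' A), ∀ y ∈ Submodule.span ℂ (e '' B),
      ⁅x, y⁆ ∈ Submodule.span ℂ (e '' D) := by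
  refine lie_mem_of_mem_span ?_
  rintro _ ⟨γ, hγ, rfl⟩ _ ⟨δ, hδ, rfl⟩
  by_cases hR : γ + δ ∈ R
  · obtain ⟨c, -, hc⟩ := he.lie_mem γ (hA hγ) δ (hB hδ) hR
    rw [hc]
    exact Submodule.smul_mem _ _ (Submodule.subset_span ⟨_, h γ hγ δ hδ hR, rfl⟩)
  · rw [he.lie_zero γ (hA hγ) δ (hB hδ) hR (h0 γ hγ δ hδ)]
    exact Submodule.zero_mem _

lemma IsRootVectors.lie_span_eq_zero (he : IsRootVectors R e) {A B : Set V} (hA : A ⊆ R)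
    (hB : B ⊆ R) (h : ∀ γ ∈ A, ∀ δ ∈ B, γ + δ ∉ R) (h0 : ∀ γ ∈ A, ∀ δ ∈ B, γ + δ ≠ 0) :
    ∀ x ∈ Submodule.span ℂ (e '' A), ∀ y ∈ Submodule.span ℂ (e '' B), ⁅x, y⁆ = 0 := by
  intro x hx y hy
  have := he.lie_mem_span (D := ∅) hA hB (fun γ hγ δ hδ hR => (h γ hγ δ hδ hR).elim) h0 x hx y hy
  simpa using this

lemma IsRootVectors.disjoint_span (he : IsRootVectors R e) {A B : Set V} (hA : A ⊆ R) (hB : B ⊆ R)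
    (h : Disjoint A B) : Disjoint (Submodule.span ℂ (e '' A)) (Submodule.span ℂ (e '' B)) :=
  ((linearIndepOn_union_iff h).1 (he.indep.mono (Set.union_subset hA hB))).2.2

/-- The functional `ξ` of a commutative polarisation can be chosen nonzero at a given vector. -/
lemma IsCommPol.exists_le_ne_zero (h : IsCommPol R e C Q) {x : L} (hx : x ≠ 0) :
    ∃ ξ : Dual ℂ L, ξ x ≠ 0 ∧
      Q.card + finrank ℂ (stabOn ξ (Submodule.span ℂ (e '' Q))) ≤ 2 * C.card := by
  obtain ⟨ξ, hξ⟩ := h.le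
  by_cases h0 : ξ x = 0
  · obtain ⟨η, hη⟩ : ∃ η : Dual ℂ L, η x ≠ 0 := by
      by_contra! hx'
      exact hx ((forall_dual_apply_eq_zero_iff ℂ x).1 hx')
    obtain ⟨t, ht, hle⟩ := exists_finrank_stabOn_le ξ η (Submodule.span ℂ (e '' Q))
    exact ⟨ξ + t • η, by simp [h0, ht, hη], by omega⟩
  · exact ⟨ξ, h0, hξ⟩

/-- Reduction of a commutative polarisation along the Heisenberg set `U ∪ {θ}` of the root `θ`. -/
lemma IsCommPol.reduce (h : IsCommPol R e C Q) (he : IsRootVectors R e) {U : Finset V} {θ : V}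
    {f ht : V →+ ℝ} (hQ : (Q : Set V) ⊆ R) (hU : (U : Set V) ⊆ R) (hθ : θ ∈ Q)
    (hpos : ∀ γ ∈ Q, 0 < ht γ) (hposU : ∀ γ ∈ U, 0 < ht γ) (hfU : ∀ γ ∈ U, f γ = 1)
    (hfθ : f θ = 2) (hdec : ∀ γ ∈ Q, f γ = 0 ∨ γ ∈ U ∨ γ = θ) (hσ : ∀ γ ∈ U, θ - γ ∈ U)
    (hUU : ∀ γ ∈ U, ∀ δ ∈ U, γ + δ ∈ R → γ + δ = θ)
    (hQU : ∀ γ ∈ Q, f γ = 0 → ∀ δ ∈ U, γ + δ ∈ R → γ + δ ∈ Q ∧ γ + δ ∈ U)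
    (hθQ : ∀ γ ∈ Q, θ + γ ∉ R) (hθU : ∀ γ ∈ U, θ + γ ∉ R)
    (hPU : ∀ γ ∈ U, γ ∈ Q ∨ θ - γ ∈ Q) :
    IsCommPol R e (C.filter fun γ => f γ = 0) (Q.filter fun γ => f γ = 0) ∧
      ∀ γ ∈ U, γ ∈ C ∨ θ - γ ∈ C := by
  have hθR := hQ hθ
  have heθ : e θ ≠ 0 := (he.indep.ne_zero hθR :)
  obtain ⟨ξ, hξθ, hξ⟩ := h.exists_le_ne_zero heθ
  set r := Q.filter fun γ => f γ = 0 with hr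
  set U' := Q.filter fun γ => γ ∈ U with hU'
  set U₀ := U.filter fun γ => θ - γ ∉ Q with hU₀
  have hrQ : r ⊆ Q := Finset.filter_subset _ _
  have hrR : (r : Set V) ⊆ R := (Finset.coe_subset.2 hrQ).trans hQ
  have hU'Q : U' ⊆ Q := Finset.filter_subset _ _
  have hU'U : U' ⊆ U := fun γ hγ => (Finset.mem_filter.1 hγ).2
  have hU₀U : U₀ ⊆ U := Finset.filter_subset _ _
  have hU₀U' : U₀ ⊆ U' := by
    intro γ hγ
    obtain ⟨h1, h2⟩ := Finset.mem_filter.1 hγ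
    exact Finset.mem_filter.2 ⟨(hPU γ h1).resolve_right h2, h1⟩
  have hθf : θ ∉ r ∪ U := by
    simp only [Finset.mem_union, not_or, hr, Finset.mem_filter, not_and]
    exact ⟨fun _ => by rw [hfθ]; norm_num, fun h => by linarith [hfU θ h]⟩
  have hdisj : Disjoint r U := by
    rw [Finset.disjoint_left]
    intro γ h1 h2
    linarith [hfU γ h2, (Finset.mem_filter.1 h1).2]
  have hadd {γ δ : V} (h1 : 0 < ht γ) (h2 : 0 < ht δ) : γ + δ ≠ 0 := fun h => by
    have := map_add ht γ δ
    rw [h, map_zero] at this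
    linarith
  have hrU : (↑(r ∪ U) : Set V) ⊆ R := by
    rw [Finset.coe_union]; exact Set.union_subset hrR hU
  have hposrU : ∀ γ ∈ r ∪ U, 0 < ht γ := fun γ hγ =>
    (Finset.mem_union.1 hγ).elim (fun h => hpos γ (hrQ h)) (hposU γ)
  have hsup : Submodule.span ℂ (e '' r) ⊔ Submodule.span ℂ (e '' U) =
      Submodule.span ℂ (e '' ↑(r ∪ U)) := by
    rw [← Submodule.span_union, ← Set.image_union, Finset.coe_union]
  have hsup' : Submodule.span ℂ (e '' r) ⊔ Submodule.span ℂ (e '' U') =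
      Submodule.span ℂ (e '' ↑(r ∪ U')) := by
    rw [← Submodule.span_union, ← Set.image_union, Finset.coe_union]
  have hQeq : Q = r ∪ U' ∪ {θ} := by
    ext γ
    simp only [Finset.mem_union, Finset.mem_singleton, hr, hU', Finset.mem_filter]
    constructor
    · intro hγ
      have := hdec γ hγ
      tauto
    · rintro ((h | h) | rfl)
      exacts [h.1, h.1, hθ]
  have hcθ : Submodule.span ℂ {e θ} = Submodule.span ℂ (e '' {θ}) := by rw [Set.image_singleton]
  have hne : ∀ δ ∈ U, ξ ⁅e (θ - δ), e δ⁆ ≠ 0 := by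
    intro δ hδ
    obtain ⟨c, hc, h⟩ := he.lie_mem (θ - δ) (hU (hσ δ hδ)) δ (hU hδ) (by simpa using hθR)
    rw [h, sub_add_cancel, map_smul, smul_eq_mul]
    exact mul_ne_zero hc hξθ
  have hUUspan := he.lie_mem_span (D := {θ}) hU hU hUU
    fun γ hγ δ hδ => hadd (hposU γ hγ) (hposU δ hδ)
  rw [← hcθ] at hUUspan
  obtain ⟨ξ', hξ'⟩ := finrank_stabOn_add_le (ξ := ξ)
    (W := Submodule.span ℂ (e '' Q)) (Z := Submodule.span ℂ (e '' r))
    (U := Submodule.span ℂ (e '' U)) (U' := Submodule.span ℂ (e '' U'))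
    (U₀ := Submodule.span ℂ (e '' U₀)) (c := e θ)
    (u := ∑ δ ∈ U, (ξ (e δ) / ξ ⁅e (θ - δ), e δ⁆) • e (θ - δ))
    (by rw [hcθ, hsup', ← Submodule.span_union, ← Set.image_union, ← Finset.coe_singleton,
          ← Finset.coe_union, ← hQeq])
    (Submodule.span_mono (Set.image_mono hU'U))
    (Submodule.span_mono (Set.image_mono hU₀U'))
    (fun x hx => by
      rw [hsup] at hx
      refine he.lie_span_eq_zero (A := {θ}) (by simpa using hθR) hrU ?_ ?_ _ (by
        rw [← hcθ]; exact Submodule.mem_span_singleton_self _) x hx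
      · rintro γ rfl δ hδ
        exact (Finset.mem_union.1 hδ).elim (fun h => hθQ δ (hrQ h)) (hθU δ)
      · rintro γ rfl δ hδ
        exact hadd (hpos _ hθ) (hposrU δ hδ))
    hUUspan
    (he.lie_mem_span hU hrR
      (fun γ hγ δ hδ hR => by
        have := hQU δ (hrQ hδ) (Finset.mem_filter.1 hδ).2 γ hγ (by rwa [add_comm])
        rw [add_comm]
        exact Finset.mem_filter.2 this)
      fun γ hγ δ hδ => hadd (hposU γ hγ) (hpos δ (hrQ hδ)))
    (fun x hx y hy => by
      rw [hsup'] at hy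
      rw [he.lie_span_eq_zero ((Finset.coe_subset.2 hU₀U).trans hU)
        ((Finset.coe_subset.2 (Finset.union_subset_union_right hU'U)).trans hrU) ?_
        (fun γ hγ δ hδ => hadd (hposU γ (hU₀U hγ))
          (hposrU δ (Finset.union_subset_union_right hU'U hδ))) x hx y hy, map_zero]
      intro γ hγ δ hδ hR
      obtain ⟨hγU, hγQ⟩ := Finset.mem_filter.1 hγ
      rcases Finset.mem_union.1 hδ with hδ | hδ
      · have h1 := hQU δ (hrQ hδ) (Finset.mem_filter.1 hδ).2 γ hγU (by rwa [add_comm])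
        have h2 := hQU δ (hrQ hδ) (Finset.mem_filter.1 hδ).2 (θ - (δ + γ)) (hσ _ h1.2)
        have h3 : δ + (θ - (δ + γ)) = θ - γ := by abel
        rw [h3] at h2
        exact hγQ (h2 (hU (hσ γ hγU))).1
      · have h1 := hUU γ hγU δ (hU'U hδ) hR
        refine hγQ ?_
        rw [← h1, add_sub_cancel_left]
        exact hU'Q hδ)
    (Submodule.sum_mem _ fun δ hδ => Submodule.smul_mem _ _
      (Submodule.subset_span ⟨_, hσ δ hδ, rfl⟩))
    (fun v hv => by
      induction hv using Submodule.span_induction with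
      | mem v hv =>
        obtain ⟨δ, hδ, rfl⟩ := hv
        rw [sum_lie]
        rw [map_sum, Finset.sum_eq_single_of_mem δ hδ]
        · rw [smul_lie, map_smul, smul_eq_mul, div_mul_cancel₀ _ (hne δ hδ)]
        · intro γ hγ hne
          rw [smul_lie, he.lie_zero (θ - γ) (hU (hσ γ hγ)) δ (hU hδ), smul_zero, map_zero]
          · intro hR
            have h1 := hUU _ (hσ γ hγ) δ hδ hR
            apply hne
            rw [sub_add_eq_add_sub, sub_eq_iff_eq_add, add_right_inj] at h1
            exact h1.symm
          · exact hadd (hposU _ (hσ γ hγ)) (hposU δ hδ)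
      | zero => simp
      | add x y _ _ hx hy => rw [lie_add, map_add, map_add, hx, hy]
      | smul c x _ hx => rw [lie_smul, map_smul, map_smul, hx])
    (fun z hz v hv t h => by
      have hv' := hsup ▸ Submodule.mem_sup_right hv
      have hz' := hsup ▸ Submodule.add_mem_sup hz hv
      have h1 : z + v = 0 := by
        refine Submodule.disjoint_def.1 (he.disjoint_span hrU
          (Set.singleton_subset_iff.2 hθR) (by simpa using hθf)) _ hz' ?_
        rw [← hcθ, Submodule.mem_span_singleton]
        exact ⟨-t, by rw [neg_smul]; exact (eq_neg_of_add_eq_zero_left h).symm⟩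
      have h2 : z = 0 := by
        refine Submodule.disjoint_def.1 (he.disjoint_span hrR hU
          (Finset.disjoint_coe.2 hdisj)) _ hz ?_
        rw [eq_neg_of_add_eq_zero_left h1]
        exact Submodule.neg_mem _ hv
      refine ⟨h2, by simpa [h2] using h1, ?_⟩
      simpa [h1, heθ] using h)
  rw [he.finrank_span ((Finset.coe_subset.2 hU₀U).trans hU)] at hξ'
  have hQcard : Q.card = r.card + U'.card + 1 := by
    have h1 : Disjoint r U' := hdisj.mono_right hU'U
    have h2 : Disjoint (r ∪ U') {θ} := Finset.disjoint_singleton_right.2 fun h =>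
      hθf (Finset.union_subset_union_right hU'U h)
    rw [hQeq, Finset.card_union_of_disjoint h2, Finset.card_union_of_disjoint h1,
      Finset.card_singleton]
  set Cr := C.filter fun γ => f γ = 0
  set CU := C.filter fun γ => γ ∈ U with hCU
  have hCcard : C.card ≤ Cr.card + CU.card + 1 := by
    refine (Finset.card_le_card (t := Cr ∪ CU ∪ {θ}) fun γ hγ => ?_).trans
      ((Finset.card_union_le _ _).trans (Nat.add_le_add_right (Finset.card_union_le _ _) _))
    have := hdec γ (h.subset hγ)
    simp only [Finset.mem_union, Finset.mem_singleton, Cr, CU, Finset.mem_filter]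
    tauto
  have hCUU : CU ⊆ U := fun γ hγ => (Finset.mem_filter.1 hγ).2
  set σCU := CU.image fun γ => θ - γ with hσCU
  have hσU : σCU ⊆ U := by
    intro γ hγ
    obtain ⟨δ, hδ, rfl⟩ := Finset.mem_image.1 hγ
    exact hσ δ (hCUU hδ)
  have hσcard : σCU.card = CU.card := Finset.card_image_of_injective _ sub_right_injective
  have hσdisj : Disjoint CU σCU := by
    rw [Finset.disjoint_right]
    intro γ hγ hγ'
    obtain ⟨δ, hδ, rfl⟩ := Finset.mem_image.1 hγ
    refine h.comm _ (Finset.mem_filter.1 hγ').1 _ (Finset.mem_filter.1 hδ).1 ?_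
    simpa using hθR
  have hle : (CU ∪ σCU).card ≤ U.card := Finset.card_le_card (Finset.union_subset hCUU hσU)
  rw [Finset.card_union_of_disjoint hσdisj, hσcard] at hle
  have hrbound := he.two_mul_card_le hrR (C := Cr) (Finset.filter_subset_filter _ h.subset)
    (fun γ hγ δ hδ => h.comm γ (Finset.mem_filter.1 hγ).1 δ (Finset.mem_filter.1 hδ).1)
    (fun γ hγ δ hδ => hadd (hpos γ (hrQ hγ)) (hpos δ (hrQ hδ))) ξ'
  have hU₀card : U.card ≤ U'.card + U₀.card := by
    refine (Finset.card_le_card (t := U' ∪ U₀.image fun γ => θ - γ) fun γ hγ => ?_).trans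
      ((Finset.card_union_le _ _).trans (Nat.add_le_add_left Finset.card_image_le _))
    by_cases hγQ : γ ∈ Q
    · exact Finset.mem_union_left _ (Finset.mem_filter.2 ⟨hγQ, hγ⟩)
    · refine Finset.mem_union_right _ (Finset.mem_image.2 ⟨θ - γ, ?_, sub_sub_cancel _ _⟩)
      exact Finset.mem_filter.2 ⟨hσ γ hγ, by rwa [sub_sub_cancel]⟩
  have hU_eq : CU ∪ σCU = U := by
    refine Finset.eq_of_subset_of_card_le (Finset.union_subset hCUU hσU) ?_
    rw [Finset.card_union_of_disjoint hσdisj, hσcard]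
    omega
  refine ⟨⟨Finset.filter_subset_filter _ h.subset, fun γ hγ δ hδ =>
    h.comm γ (Finset.mem_filter.1 hγ).1 δ (Finset.mem_filter.1 hδ).1, ξ', by omega⟩, ?_⟩
  intro γ hγ
  rw [← hU_eq] at hγ
  rcases Finset.mem_union.1 hγ with hγ | hγ
  · exact Or.inl (Finset.mem_filter.1 hγ).1
  · obtain ⟨δ, hδ, rfl⟩ := Finset.mem_image.1 hγ
    exact Or.inr (by simpa using (Finset.mem_filter.1 hδ).1)

end Polarisation

lemma exists_leading_term {V L : Type*} [AddCommGroup L] [Module ℂ L] {e : V → L} {M : Finset V}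
    {φ : V → ℚ} (hφ : Set.InjOn φ M) {x : L}
    (hx : x ∈ Submodule.span ℂ (e '' M)) (h0 : x ≠ 0) :
    ∃ γ ∈ M, ∃ c : ℂ, c ≠ 0 ∧
      ∃ y ∈ Submodule.span ℂ (e '' {δ | δ ∈ M ∧ φ δ < φ γ}), x = c • e γ + y := by
  obtain ⟨c', hc'⟩ := (Submodule.mem_span_image_finset_iff_exists_fun ℂ).1 hx
  set c : V → ℂ := fun γ => if h : γ ∈ M then c' ⟨γ, h⟩ else 0 with hcdef
  have hc : ∑ γ ∈ M, c γ • e γ = x := by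
    rw [← hc', ← Finset.sum_coe_sort]
    exact Finset.sum_congr rfl fun γ _ => by simp [hcdef]
  have hne : (M.filter fun γ => c γ ≠ 0).Nonempty := by
    by_contra! h
    refine h0 (hc ▸ Finset.sum_eq_zero fun γ hγ => ?_)
    have := (Finset.filter_eq_empty_iff.1 h) hγ
    simp_all
  obtain ⟨γ, hγ, hmax⟩ := Finset.exists_max_image _ φ hne
  obtain ⟨hγM, hcγ⟩ := Finset.mem_filter.1 hγ
  refine ⟨γ, hγM, c γ, hcγ, ∑ δ ∈ M.erase γ, c δ • e δ, Submodule.sum_mem _ fun δ hδ => ?_, ?_⟩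
  · obtain ⟨hne, hδM⟩ := Finset.mem_erase.1 hδ
    by_cases hcδ : c δ = 0
    · simp [hcδ]
    · refine Submodule.smul_mem _ _ (Submodule.subset_span ⟨δ, ⟨hδM, ?_⟩, rfl⟩)
      exact (hmax δ (Finset.mem_filter.2 ⟨hδM, hcδ⟩)).lt_of_ne fun h => hne (hφ hδM hγM h)
  · rw [Finset.add_sum_erase M (fun δ => c δ • e δ) hγM, hc]

section Polarisation

variable {V L : Type*} [AddCommGroup V] [LieRing L] [LieAlgebra ℂ L]
  {R : Set V} {e : V → L}

/-- The leading roots of an abelian subspace form a commutative set of at least the same size. -/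
lemma IsRootVectors.exists_comm_card_le [Module ℚ V] (he : IsRootVectors R e) {P : Finset V}
    (hP : (P : Set V) ⊆ R) (h0 : ∀ γ ∈ P, ∀ δ ∈ P, γ + δ ≠ 0) {A : Submodule ℂ L}
    (hA : A ≤ Submodule.span ℂ (e '' P)) (hab : ∀ x ∈ A, ∀ y ∈ A, ⁅x, y⁆ = 0) :
    ∃ C ⊆ P, (∀ γ ∈ C, ∀ δ ∈ C, γ + δ ∉ R) ∧ finrank ℂ A ≤ C.card := by
  obtain ⟨φ, hφ⟩ := Module.exists_dual_forall_apply_ne_zero (K := ℚ)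
    (fun p : {p : P × P // p.1 ≠ p.2} => (p.1.1 : V) - p.1.2)
    (fun p => sub_ne_zero.2 fun h => p.2 (Subtype.ext h))
  have hinj : Set.InjOn φ P := by
    intro γ hγ δ hδ h
    by_contra hne
    exact hφ ⟨⟨⟨γ, hγ⟩, ⟨δ, hδ⟩⟩, fun h => hne (congrArg Subtype.val h)⟩ (by simp [h])
  set C := P.filter fun γ => ∃ x ∈ A, ∃ c : ℂ, c ≠ 0 ∧
    ∃ y ∈ Submodule.span ℂ (e '' {δ | δ ∈ P ∧ φ δ < φ γ}), x = c • e γ + y with hC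
  refine ⟨C, Finset.filter_subset _ _, ?_, ?_⟩
  · intro γ hγ δ hδ hR
    obtain ⟨hγP, x, hx, c, hc, y, hy, rfl⟩ := Finset.mem_filter.1 hγ
    obtain ⟨hδP, x', hx', c', hc', y', hy', rfl⟩ := Finset.mem_filter.1 hδ
    have hzero := hab _ hx _ hx'
    set D := {η | η ∈ R ∧ φ η < φ γ + φ δ} with hD
    have hsub (ρ : V) : {δ | δ ∈ P ∧ φ δ < φ ρ} ⊆ R := fun η hη => hP hη.1
    have hspan {ρ : V} (hρ : ρ ∈ P) {A : Set V} (hA : ρ ∈ A) :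
        e ρ ∈ Submodule.span ℂ (e '' A) := Submodule.subset_span ⟨ρ, hA, rfl⟩
    have h1 : ⁅e γ, y'⁆ ∈ Submodule.span ℂ (e '' D) :=
      he.lie_mem_span (A := {γ}) (by simpa using hP hγP) (hsub δ)
        (by rintro _ rfl η hη hηR; exact ⟨hηR, by rw [map_add]; linarith [hη.2]⟩)
        (by rintro _ rfl η hη; exact h0 _ hγP _ hη.1) _ (hspan hγP rfl) _ hy'
    have h2 : ⁅y, e δ⁆ ∈ Submodule.span ℂ (e '' D) :=
      he.lie_mem_span (B := {δ}) (hsub γ) (by simpa using hP hδP)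
        (by rintro η hη _ rfl hηR; exact ⟨hηR, by rw [map_add]; linarith [hη.2]⟩)
        (by rintro η hη _ rfl; exact h0 _ hη.1 _ hδP) _ hy _ (hspan hδP rfl)
    have h3 : ⁅y, y'⁆ ∈ Submodule.span ℂ (e '' D) :=
      he.lie_mem_span (hsub γ) (hsub δ)
        (by intro η hη η' hη' hηR; exact ⟨hηR, by rw [map_add]; linarith [hη.2, hη'.2]⟩)
        (by intro η hη η' hη'; exact h0 _ hη.1 _ hη'.1) _ hy _ hy'
    obtain ⟨a, ha, hl⟩ := he.lie_mem γ (hP hγP) δ (hP hδP) hR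
    have h4 : (c * (c' * a)) • e (γ + δ) ∈ Submodule.span ℂ (e '' D) := by
      have : (c * (c' * a)) • e (γ + δ) = -(c • ⁅e γ, y'⁆ + c' • ⁅y, e δ⁆ + ⁅y, y'⁆) := by
        rw [eq_neg_iff_add_eq_zero, ← hzero]
        simp only [lie_add, add_lie, smul_lie, lie_smul, hl]
        module
      rw [this]
      exact Submodule.neg_mem _ (Submodule.add_mem _ (Submodule.add_mem _
        (Submodule.smul_mem _ _ h1) (Submodule.smul_mem _ _ h2)) h3)
    have h5 := Submodule.disjoint_def.1 (he.disjoint_span (A := {γ + δ}) (B := D)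
      (by simpa using hR) (fun η hη => hη.1) (by simp [hD])) _
      (Submodule.smul_mem _ _ (Submodule.subset_span ⟨_, rfl, rfl⟩)) h4
    exact smul_ne_zero (mul_ne_zero hc (mul_ne_zero hc' ha)) (he.indep.ne_zero hR :) h5
  · set M := P.filter fun γ => γ ∉ C with hM
    have hMP : M ⊆ P := Finset.filter_subset _ _
    have hMsub := Finset.coe_subset.2 hMP
    have hdis : Disjoint A (Submodule.span ℂ (e '' M)) := by
      rw [Submodule.disjoint_def]
      intro x hxA hxM
      by_contra hx0
      obtain ⟨γ, hγ, c, hc, y, hy, hxy⟩ := exists_leading_term (hinj.mono hMsub) hxM hx0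
      refine (Finset.mem_filter.1 hγ).2 (Finset.mem_filter.2 ⟨hMP hγ, x, hxA, c, hc, y, ?_, hxy⟩)
      refine Submodule.span_mono (Set.image_mono ?_) hy
      exact fun η (hη : η ∈ M ∧ φ η < φ γ) => ⟨hMP hη.1, hη.2⟩
    have : FiniteDimensional ℂ A := Submodule.finiteDimensional_of_le hA
    have h1 := Submodule.finrank_sup_add_finrank_inf_eq A (Submodule.span ℂ (e '' M))
    have h3 := Submodule.finrank_mono (sup_le hA (Submodule.span_mono (Set.image_mono hMsub)))
    rw [hdis.eq_bot, finrank_bot, he.finrank_span (hMsub.trans hP)] at h1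
    rw [he.finrank_span hP] at h3
    have h2 : C.card + M.card = P.card := by
      rw [hM, ← Finset.card_filter_add_card_filter_not (s := P) (fun γ => γ ∈ C)]
      congr 2
      ext γ
      simp only [Finset.mem_filter, hC]
      tauto
    omega

end Polarisation

namespace CascadeSetting

variable {g : Type} [LieRing g] [LieAlgebra ℂ g] [FiniteDimensional ℂ g]
variable (cs : CascadeSetting g)

lemma coe_nRoots_subset (T : Finset (Dual ℂ cs.H)) :
    (cs.nRoots T : Set (Dual ℂ cs.H)) ⊆ cs.R :=
  fun _ h => cs.Rpos_subset (Finset.mem_filter.1 h).1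

lemma add_ne_zero_of_mem_Rpos {γ δ : Dual ℂ cs.H} (hγ : γ ∈ cs.Rpos) (hδ : δ ∈ cs.Rpos) :
    γ + δ ≠ 0 := fun h => cs.not_neg_mem γ hγ (neg_eq_of_add_eq_zero_right h ▸ hδ)

lemma exists_isCommPol_of_hasCP {T : Finset (Dual ℂ cs.H)} (hT : T ⊆ cs.S)
    (h : HasCP ℂ (cs.nT T)) : ∃ C, IsCommPol (cs.R : Set (Dual ℂ cs.H)) cs.e C (cs.nRoots T) := by
  obtain ⟨-, he, hsp⟩ := cs.exists_rootForm_rootVectors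
  obtain ⟨a, ha, hdim⟩ := h
  set P := cs.nRoots T
  have hnT : (cs.nT T).toSubmodule = Submodule.span ℂ (cs.e '' P) := by
    rw [cs.nT_def T hT, Set.image_eq_iUnion, Submodule.span_iUnion₂]
    exact iSup_congr fun γ => iSup_congr fun hγ => hsp γ (cs.coe_nRoots_subset T hγ)
  obtain ⟨ξ, hξ⟩ := Nat.sInf_mem
    (s := {n | ∃ ξ : Dual ℂ (cs.nT T), n = finrank ℂ (coadjointStab ℂ (cs.nT T) ξ)}) ⟨_, 0, rfl⟩
  obtain ⟨ξ', hξ'⟩ := LinearMap.exists_extend (p := (cs.nT T).toSubmodule) ξ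
  have hstab : stabOn ξ' (Submodule.span ℂ (cs.e '' P)) =
      (coadjointStab ℂ (cs.nT T) ξ).map (cs.nT T).toSubmodule.subtype := by
    rw [← hnT]
    have hval (z : cs.nT T) : ξ' z = ξ z := LinearMap.congr_fun hξ' z
    ext x
    rw [mem_stabOn, Submodule.mem_map]
    constructor
    · rintro ⟨hx, hxy⟩
      refine ⟨⟨x, hx⟩, fun y => ?_, rfl⟩
      rw [← hval]
      exact hxy y y.2
    · rintro ⟨x, hx, rfl⟩
      refine ⟨x.2, fun y hy => ?_⟩
      have := hx ⟨y, hy⟩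
      rwa [← hval] at this
  obtain ⟨C, hCP, hC, hcard⟩ := he.exists_comm_card_le (cs.coe_nRoots_subset T)
    (fun γ hγ δ hδ => cs.add_ne_zero_of_mem_Rpos (Finset.mem_filter.1 hγ).1
      (Finset.mem_filter.1 hδ).1)
    (A := a.toSubmodule.map (cs.nT T).toSubmodule.subtype)
    (hnT ▸ Submodule.map_subtype_le _ _) (by
      rintro _ ⟨x, hx, rfl⟩ _ ⟨y, hy, rfl⟩
      have := congrArg (fun z : a => ((z : cs.nT T) : g)) (ha.trivial ⟨x, hx⟩ ⟨y, hy⟩)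
      simpa using this)
  refine ⟨C, hCP, hC, ξ', ?_⟩
  have h1 : finrank ℂ (a.toSubmodule.map (cs.nT T).toSubmodule.subtype) = finrank ℂ a :=
    LinearEquiv.finrank_eq (Submodule.equivSubtypeMap _ _).symm
  have h2 : finrank ℂ (cs.nT T) = P.card := by
    rw [← he.finrank_span (cs.coe_nRoots_subset T), ← hnT]; rfl
  have h3 : finrank ℂ (stabOn ξ' (Submodule.span ℂ (cs.e '' P))) = lieIndex ℂ (cs.nT T) := by
    rw [hstab, lieIndex, hξ]
    exact LinearEquiv.finrank_eq (Submodule.equivSubtypeMap _ _).symm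
  rw [h1] at hcard
  rw [bHalf, h2, ← h3] at hdim
  have : (P.card + finrank ℂ (stabOn ξ' (Submodule.span ℂ (cs.e '' P))) : ℚ) =
      2 * finrank ℂ a := by linarith
  have : P.card + finrank ℂ (stabOn ξ' (Submodule.span ℂ (cs.e '' P))) = 2 * finrank ℂ a := by
    exact_mod_cast this
  omega

end CascadeSetting

section TypeD

variable {V : Type*} [AddCommGroup V] {R : Set V} {b : V → V → ℝ}

namespace IsRootForm

variable (h : IsRootForm R b)
include h

lemma add_right (x y z : V) : b x (y + z) = b x y + b x z := by
  rw [h.symm, h.add_left, h.symm y, h.symm z]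

lemma sub_left (x y z : V) : b (x - y) z = b x z - b y z := by
  have := h.add_left (x - y) y z
  rw [sub_add_cancel] at this
  linarith

lemma sub_right (x y z : V) : b x (y - z) = b x y - b x z := by
  rw [h.symm, h.sub_left, h.symm y, h.symm z]

lemma zero_left (x : V) : b 0 x = 0 := by
  simpa using h.sub_left 0 0 x

lemma neg_left (x y : V) : b (-x) y = -b x y := by
  have := h.sub_left 0 x y
  rw [zero_sub, h.zero_left] at this
  linarith

lemma neg_right (x y : V) : b x (-y) = -b x y := by
  rw [h.symm, h.neg_left, h.symm y]

lemma ne_zero {γ : V} (hγ : γ ∈ R) : γ ≠ 0 := fun h0 => h.zero_notMem (h0 ▸ hγ)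

lemma self_pos {γ : V} (hγ : γ ∈ R) : 0 < b γ γ :=
  h.pos γ (AddSubgroup.subset_closure hγ) (h.ne_zero hγ)

/-- Pairing with the coroot of `α`. -/
def pairing (α : V) : V →+ ℝ :=
  AddMonoidHom.mk' (fun x => 2 * b α x / b α α) fun x y => by
    rw [h.add_right]; ring

lemma pairing_mul {α : V} (hα : α ∈ R) (x : V) : h.pairing α x * b α α = 2 * b α x :=
  div_mul_cancel₀ _ (h.self_pos hα).ne'

lemma pairing_self {α : V} (hα : α ∈ R) : h.pairing α α = 2 :=
  mul_div_cancel_right₀ _ (h.self_pos hα).ne'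

lemma exists_pairing_eq {α β : V} (hα : α ∈ R) (hβ : β ∈ R) :
    ∃ z : ℤ, h.pairing α β = z ∧ β - z • α ∈ R := by
  obtain ⟨z, hz, hzR⟩ := h.reflection α hα β hβ
  refine ⟨z, ?_, hzR⟩
  have := h.pairing_mul hα β
  rw [hz] at this
  exact mul_right_cancel₀ (h.self_pos hα).ne' this

lemma sub_mem_of_pairing_pos {α β : V} (hα : α ∈ R) (hβ : β ∈ R) (hp : 0 < h.pairing α β)
    (hne : α ≠ β) : β - α ∈ R := by
  refine h.sub_mem α hα β hβ ?_ hne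
  have := h.pairing_mul hα β
  have := mul_pos hp (h.self_pos hα)
  linarith

end IsRootForm

/-- The vectors `ε i ± ε j`, `i < j < N`. -/
def dRoots (ε : ℕ → V) (N : ℕ) : Set V :=
  {γ | ∃ i j, i < j ∧ j < N ∧ (γ = ε i + ε j ∨ γ = ε i - ε j)}

/-- `R` is a set of roots such that any relation between its positive roots (those of positive
height) takes place among the vectors `ε i ± ε j`, `i < j < N`. -/
structure IsTypeDLevel (R : Set V) (b : V → V → ℝ) (ht : V →+ ℝ) (ε : ℕ → V) (N : ℕ) : Prop where
  form : IsRootForm R b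
  finite : R.Finite
  inj : ∀ i < N, ∀ j < N, ε i = ε j → i = j
  dRoots_subset : dRoots ε N ⊆ R
  ht_pos : ∀ γ ∈ dRoots ε N, 0 < ht γ
  ht_ne : ∀ γ ∈ R, ht γ ≠ 0
  sum : ∀ γ ∈ R, ∀ δ ∈ R, 0 < ht γ → 0 < ht δ → γ + δ ∈ R →
    γ ∈ dRoots ε N ∧ δ ∈ dRoots ε N ∧ γ + δ ∈ dRoots ε N

namespace IsTypeDLevel

variable {ht : V →+ ℝ} {ε : ℕ → V} {N : ℕ} (h : IsTypeDLevel R b ht ε N)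
include h

lemma eps_add_eps_mem {i j : ℕ} (hij : i < j) (hj : j < N) : ε i + ε j ∈ R :=
  h.dRoots_subset ⟨i, j, hij, hj, Or.inl rfl⟩

lemma eps_sub_eps_mem {i j : ℕ} (hij : i < j) (hj : j < N) : ε i - ε j ∈ R :=
  h.dRoots_subset ⟨i, j, hij, hj, Or.inr rfl⟩

lemma neg_lt_ht {i j : ℕ} (hij : i < j) (hj : j < N) : -ht (ε j) < ht (ε i) := by
  have := h.ht_pos _ ⟨i, j, hij, hj, Or.inl rfl⟩
  rw [map_add] at this; linarith

lemma ht_lt {i j : ℕ} (hij : i < j) (hj : j < N) : ht (ε j) < ht (ε i) := by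
  have := h.ht_pos _ ⟨i, j, hij, hj, Or.inr rfl⟩
  rw [map_sub] at this; linarith

lemma ht_le {i j : ℕ} (hij : i ≤ j) (hj : j < N) : ht (ε j) ≤ ht (ε i) := by
  rcases hij.eq_or_lt with rfl | hij
  · rfl
  · exact (h.ht_lt hij hj).le

lemma ht_neg {γ : V} (hγ : γ ∈ R) (hn : ¬ 0 < ht γ) : -γ ∈ R ∧ 0 < ht (-γ) := by
  refine ⟨h.form.neg_mem γ hγ, ?_⟩
  rw [map_neg]
  have := (not_lt.1 hn).lt_of_ne (h.ht_ne γ hγ)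
  linarith

lemma ht_one_pos (hN : 3 ≤ N) : 0 < ht (ε 1) := by
  have h1 := h.ht_lt (i := 1) (j := 2) (by omega) (by omega)
  have h2 := h.neg_lt_ht (i := 1) (j := 2) (by omega) (by omega)
  linarith

lemma theta_mem (hN : 3 ≤ N) : ε 0 + ε 1 ∈ R := h.eps_add_eps_mem (by omega) (by omega)

lemma ht_le_theta (hN : 3 ≤ N) {γ : V} (hγ : γ ∈ dRoots ε N) : ht γ ≤ ht (ε 0 + ε 1) := by
  obtain ⟨i, j, hij, hj, rfl | rfl⟩ := hγ
  · have h1 := h.ht_le (Nat.zero_le i) (hij.trans hj)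
    have h2 := h.ht_le (i := 1) (j := j) (by omega) hj
    simp only [map_add]
    linarith
  · have h1 := h.ht_le (Nat.zero_le i) (hij.trans hj)
    have h2 : -ht (ε j) ≤ ht (ε 1) := by
      obtain rfl | hj1 : j = 1 ∨ 1 < j := by omega
      · linarith [h.ht_one_pos hN]
      · exact (h.neg_lt_ht hj1 hj).le
    simp only [map_add, map_sub]
    linarith

lemma theta_add_notMem (hN : 3 ≤ N) {γ : V} (hγ : γ ∈ R) (hp : 0 < ht γ) :
    ε 0 + ε 1 + γ ∉ R := by
  intro hR
  have hθ : ε 0 + ε 1 ∈ dRoots ε N := ⟨0, 1, by omega, by omega, Or.inl rfl⟩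
  have := h.ht_le_theta hN (h.sum _ (h.theta_mem hN) _ hγ (h.ht_pos _ hθ) hp hR).2.2
  rw [map_add ht _ γ] at this
  linarith

/-- Pairing with the coroot of the highest root `ε 0 + ε 1`. -/
local notation "𝔣" => IsRootForm.pairing (IsTypeDLevel.form h) (ε 0 + ε 1)

lemma pairing_theta_nonneg (hN : 3 ≤ N) {γ : V} (hγ : γ ∈ R) (hp : 0 < ht γ) : 0 ≤ 𝔣 γ := by
  by_contra! hn
  have hθ := h.theta_mem hN
  have h1 : 0 < 𝔣 (-γ) := by rw [map_neg]; linarith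
  have h2 := h.form.sub_mem_of_pairing_pos hθ (h.form.neg_mem γ hγ) h1 (by
    intro he
    have h3 := h.ht_pos _ ⟨0, 1, by omega, by omega, Or.inl rfl⟩
    rw [he, map_neg] at h3
    linarith)
  refine h.theta_add_notMem hN hγ hp ?_
  convert h.form.neg_mem _ h2 using 1
  abel

lemma theta_sub_mem (hN : 3 ≤ N) {γ : V} (hγ : γ ∈ R) (hp : 0 < 𝔣 γ)
    (hne : γ ≠ ε 0 + ε 1) : ε 0 + ε 1 - γ ∈ R ∧ 0 < ht (ε 0 + ε 1 - γ) := by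
  have h1 := h.form.sub_mem_of_pairing_pos (h.theta_mem hN) hγ hp hne.symm
  have h2 : ¬ 0 < ht (γ - (ε 0 + ε 1)) := fun h3 =>
    h.theta_add_notMem hN h1 h3 (by rwa [add_sub_cancel])
  simpa using h.ht_neg h1 h2

lemma pairing_theta (hN : 3 ≤ N) {γ : V} (hγ : γ ∈ R) (hp : 0 < ht γ)
    (hne : γ ≠ ε 0 + ε 1) : 𝔣 γ = 0 ∨ 𝔣 γ = 1 := by
  have hθ := h.theta_mem hN
  obtain ⟨z, hz, hzR⟩ := h.form.exists_pairing_eq hθ hγ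
  have h0 := h.pairing_theta_nonneg hN hγ hp
  by_contra! hcon
  have hz2 : 2 ≤ z := by
    rw [hz] at hcon h0
    have h1 : 0 ≤ z := by exact_mod_cast h0
    have h2 : z ≠ 0 := by exact_mod_cast hcon.1
    have h3 : z ≠ 1 := by exact_mod_cast hcon.2
    omega
  have hz2' : (2 : ℝ) ≤ z := by exact_mod_cast hz2
  obtain ⟨h1, h2⟩ := h.theta_sub_mem hN hγ (by rw [hz]; linarith) hne
  have h3 := h.pairing_theta_nonneg hN h1 h2
  rw [map_sub, h.form.pairing_self hθ, hz] at h3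
  obtain rfl : z = 2 := by
    have : z ≤ 2 := by
      have : (z : ℝ) ≤ 2 := by linarith
      exact_mod_cast this
    omega
  refine h.theta_add_notMem hN h1 h2 ?_
  convert h.form.neg_mem _ hzR using 1
  rw [two_smul]
  abel

lemma pairing_theta_eq_zero (hN : 3 ≤ N) {γ : V} (hγ : γ ∈ R) (hp : 0 < ht γ)
    (hD : γ ∉ dRoots ε N) : 𝔣 γ = 0 := by
  have hθ : ε 0 + ε 1 ∈ dRoots ε N := ⟨0, 1, by omega, by omega, Or.inl rfl⟩
  have hne : γ ≠ ε 0 + ε 1 := fun he => hD (he ▸ hθ)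
  by_contra h0
  obtain ⟨h1, h2⟩ := h.theta_sub_mem hN hγ
    ((h.pairing_theta_nonneg hN hγ hp).lt_of_ne' h0) hne
  exact hD (h.sum γ hγ _ h1 hp h2 (by rw [add_sub_cancel]; exact h.theta_mem hN)).1

lemma pairing_theta_eps (hN : 3 ≤ N) :
    𝔣 (ε 0) = 1 ∧ 𝔣 (ε 1) = 1 ∧ ∀ k, 2 ≤ k → k < N → 𝔣 (ε k) = 0 := by
  have h1 := h.ht_one_pos hN
  have key : ∀ i j, i < j → j < N → 1 < j →
      (𝔣 (ε i) + 𝔣 (ε j) = 0 ∨ 𝔣 (ε i) + 𝔣 (ε j) = 1) ∧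
      (𝔣 (ε i) - 𝔣 (ε j) = 0 ∨ 𝔣 (ε i) - 𝔣 (ε j) = 1) := by
    intro i j hij hj hj1
    have h2 := h.ht_le (Nat.zero_le i) (hij.trans hj)
    have h3 := h.ht_lt hj1 hj
    have h4 := h.neg_lt_ht hj1 hj
    rw [← map_add, ← map_sub]
    constructor
    · refine h.pairing_theta hN (h.eps_add_eps_mem hij hj) (h.ht_pos _ ⟨i, j, hij, hj, Or.inl rfl⟩) ?_
      intro he
      have := congrArg ht he
      simp only [map_add] at this
      linarith
    · refine h.pairing_theta hN (h.eps_sub_eps_mem hij hj) (h.ht_pos _ ⟨i, j, hij, hj, Or.inr rfl⟩) ?_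
      intro he
      have := congrArg ht he
      simp only [map_add, map_sub] at this
      linarith
  have hα : 𝔣 (ε 0) - 𝔣 (ε 1) = 0 ∨ 𝔣 (ε 0) - 𝔣 (ε 1) = 1 := by
    rw [← map_sub]
    refine h.pairing_theta hN (h.eps_sub_eps_mem (by omega) (by omega))
      (h.ht_pos _ ⟨0, 1, by omega, by omega, Or.inr rfl⟩) ?_
    intro he
    have := congrArg ht he
    simp only [map_add, map_sub] at this
    linarith
  have hθ := h.form.pairing_self (h.theta_mem hN)
  rw [map_add] at hθ
  have k0 := key 0 2 (by omega) (by omega) (by omega)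
  have k1 := key 1 2 (by omega) (by omega) (by omega)
  have e0 : 𝔣 (ε 0) = 1 := by grind
  have e1 : 𝔣 (ε 1) = 1 := by linarith
  refine ⟨e0, e1, fun k hk hkN => ?_⟩
  have := key 0 k (by omega) hkN (by omega)
  grind

end IsTypeDLevel
end TypeD

section TypeD

variable {V : Type*} [AddCommGroup V] {R : Set V} {b : V → V → ℝ}

/-- The vectors `ε k` and `-ε k` for `2 ≤ k < N`. -/
def signedEps (ε : ℕ → V) (N k : ℕ) : Set V := {η | 2 ≤ k ∧ k < N ∧ (η = ε k ∨ η = -ε k)}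

lemma neg_mem_signedEps {ε : ℕ → V} {N k : ℕ} {η : V} (hη : η ∈ signedEps ε N k) :
    -η ∈ signedEps ε N k := by
  obtain ⟨h2, hN, rfl | rfl⟩ := hη
  · exact ⟨h2, hN, Or.inr rfl⟩
  · exact ⟨h2, hN, Or.inl (neg_neg _)⟩

lemma eps_add_mem_dRoots {ε : ℕ → V} {N i k : ℕ} {η : V} (hi : i < 2) (hη : η ∈ signedEps ε N k) :
    ε i + η ∈ dRoots ε N := by
  obtain ⟨h2, hN, rfl | rfl⟩ := hη
  · exact ⟨i, k, by omega, hN, Or.inl rfl⟩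
  · exact ⟨i, k, by omega, hN, Or.inr (by abel)⟩

namespace IsTypeDLevel

variable {ht : V →+ ℝ} {ε : ℕ → V} {N : ℕ} (h : IsTypeDLevel R b ht ε N)
include h

local notation "𝔣" => IsRootForm.pairing (IsTypeDLevel.form h) (ε 0 + ε 1)
local notation "𝔮" => IsRootForm.pairing (IsTypeDLevel.form h) (ε 0 - ε 1)

lemma signed_add_mem {j k : ℕ} {η η' : V} (hη : η ∈ signedEps ε N j)
    (hη' : η' ∈ signedEps ε N k) (hjk : j ≠ k) : η + η' ∈ R := by
  wlog hlt : j < k generalizing j k η η'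
  · rw [add_comm]
    exact this hη' hη hjk.symm (by omega)
  have h1 := h.eps_add_eps_mem hlt hη'.2.1
  have h2 := h.eps_sub_eps_mem hlt hη'.2.1
  obtain ⟨-, -, rfl | rfl⟩ := hη <;> obtain ⟨-, -, rfl | rfl⟩ := hη'
  · exact h1
  · rwa [← sub_eq_add_neg]
  · convert h.form.neg_mem _ h2 using 1; abel
  · convert h.form.neg_mem _ h1 using 1; abel

lemma signed_sub_mem {j k : ℕ} {η η' : V} (hη : η ∈ signedEps ε N j)
    (hη' : η' ∈ signedEps ε N k) (hjk : j ≠ k) : η - η' ∈ R := by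
  rw [sub_eq_add_neg]
  exact h.signed_add_mem hη (neg_mem_signedEps hη') hjk

lemma signed_ne {j k : ℕ} {η η' : V} (hη : η ∈ signedEps ε N j)
    (hη' : η' ∈ signedEps ε N k) (hjk : j ≠ k) : η ≠ η' :=
  sub_ne_zero.1 (h.form.ne_zero (h.signed_sub_mem hη hη' hjk))

lemma pairing_theta_signed {k : ℕ} {η : V} (hη : η ∈ signedEps ε N k) : 𝔣 η = 0 := by
  obtain ⟨h2, hN, rfl | rfl⟩ := hη
  · exact (h.pairing_theta_eps (by omega)).2.2 k h2 hN
  · rw [map_neg, (h.pairing_theta_eps (by omega)).2.2 k h2 hN, neg_zero]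

lemma pos_of_pairing_eq_one (hN : 3 ≤ N) {γ : V} (hγ : γ ∈ R) (hf : 𝔣 γ = 1) : 0 < ht γ := by
  by_contra hn
  obtain ⟨h1, h2⟩ := h.ht_neg hγ hn
  have := h.pairing_theta_nonneg hN h1 h2
  rw [map_neg] at this
  linarith

lemma exists_of_pairing_eq_one (hN : 3 ≤ N) {γ : V} (hγ : γ ∈ R) (hf : 𝔣 γ = 1) :
    ∃ k, ∃ η ∈ signedEps ε N k, γ = ε 0 + η ∨ γ = ε 1 + η := by
  have hp := h.pos_of_pairing_eq_one hN hγ hf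
  obtain ⟨e0, e1, ek⟩ := h.pairing_theta_eps hN
  by_cases hD : γ ∈ dRoots ε N
  · obtain ⟨i, j, hij, hj, hγ'⟩ := hD
    have hi : i = 0 ∨ i = 1 ∨ 2 ≤ i := by omega
    have hj' : j = 1 ∨ 2 ≤ j := by omega
    have h2 : 2 ≤ j ∧ (i = 0 ∨ i = 1) := by
      rcases hj' with rfl | hj2
      · obtain rfl : i = 0 := by omega
        rcases hγ' with rfl | rfl
        · rw [map_add] at hf; linarith
        · rw [map_sub] at hf; linarith
      · rcases hi with rfl | rfl | hi
        · exact ⟨hj2, Or.inl rfl⟩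
        · exact ⟨hj2, Or.inr rfl⟩
        · rcases hγ' with rfl | rfl
          · rw [map_add, ek i hi (by omega), ek j hj2 hj] at hf; linarith
          · rw [map_sub, ek i hi (by omega), ek j hj2 hj] at hf; linarith
    rcases hγ' with rfl | rfl
    · exact ⟨j, ε j, ⟨h2.1, hj, Or.inl rfl⟩, by rcases h2.2 with rfl | rfl <;> simp⟩
    · exact ⟨j, -ε j, ⟨h2.1, hj, Or.inr rfl⟩, by
        rcases h2.2 with rfl | rfl <;> simp [sub_eq_add_neg]⟩
  · rw [h.pairing_theta_eq_zero hN hγ hp hD] at hf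
    linarith

lemma eq_of_pairing_eq_zero (hN : 3 ≤ N) {γ : V} (hγ : γ ∈ dRoots ε N) (hf : 𝔣 γ = 0) :
    γ = ε 0 - ε 1 ∨ ∃ i j, 2 ≤ i ∧ i < j ∧ j < N ∧ (γ = ε i + ε j ∨ γ = ε i - ε j) := by
  obtain ⟨e0, e1, ek⟩ := h.pairing_theta_eps hN
  obtain ⟨i, j, hij, hj, hγ'⟩ := hγ
  by_cases hi : 2 ≤ i
  · exact Or.inr ⟨i, j, hi, hij, hj, hγ'⟩
  have ei : 𝔣 (ε i) = 1 := by
    obtain rfl | rfl : i = 0 ∨ i = 1 := by omega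
    · exact e0
    · exact e1
  by_cases hj2 : 2 ≤ j
  · have := ek j hj2 hj
    rcases hγ' with rfl | rfl
    · rw [map_add] at hf; linarith
    · rw [map_sub] at hf; linarith
  · obtain rfl : i = 0 := by omega
    obtain rfl : j = 1 := by omega
    rcases hγ' with rfl | rfl
    · rw [map_add] at hf; linarith
    · exact Or.inl rfl

lemma alpha_mem (hN : 3 ≤ N) : ε 0 - ε 1 ∈ R := h.eps_sub_eps_mem (by omega) (by omega)

lemma form_theta_alpha (hN : 3 ≤ N) : b (ε 0 + ε 1) (ε 0 - ε 1) = 0 := by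
  obtain ⟨e0, e1, -⟩ := h.pairing_theta_eps hN
  have := h.form.pairing_mul (h.theta_mem hN) (ε 0 - ε 1)
  rw [map_sub, e0, e1] at this
  linarith

lemma form_theta_signed {k : ℕ} {η : V} (hη : η ∈ signedEps ε N k) : b (ε 0 + ε 1) η = 0 := by
  have := h.form.pairing_mul (h.theta_mem (by have := hη.1; have := hη.2.1; omega)) η
  rw [h.pairing_theta_signed hη] at this
  linarith

lemma pairing_alpha_eps (hN : 3 ≤ N) : 𝔮 (ε 0) = 1 ∧ 𝔮 (ε 1) = -1 := by
  have h1 := h.form.pairing_self (h.alpha_mem hN)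
  have h2 := h.form.pairing_mul (h.alpha_mem hN) (ε 0 + ε 1)
  rw [h.form.symm _ (ε 0 + ε 1), h.form_theta_alpha hN, mul_zero] at h2
  have h3 := (mul_eq_zero.1 h2).resolve_right (h.form.self_pos (h.alpha_mem hN)).ne'
  rw [map_sub] at h1
  rw [map_add] at h3
  constructor <;> linarith

lemma form_zero_signed {k : ℕ} {η : V} (hη : η ∈ signedEps ε N k) :
    2 * b (ε 0) η = b (ε 0 - ε 1) η := by
  have := h.form_theta_signed hη
  rw [h.form.add_left] at this
  rw [h.form.sub_left]
  linarith

lemma form_one_signed {k : ℕ} {η : V} (hη : η ∈ signedEps ε N k) :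
    2 * b (ε 1) η = -b (ε 0 - ε 1) η := by
  have := h.form_theta_signed hη
  rw [h.form.add_left] at this
  rw [h.form.sub_left]
  linarith

lemma form_zero_zero (hN : 3 ≤ N) :
    4 * b (ε 0) (ε 0) = b (ε 0 + ε 1) (ε 0 + ε 1) + b (ε 0 - ε 1) (ε 0 - ε 1) ∧
    4 * b (ε 1) (ε 1) = b (ε 0 + ε 1) (ε 0 + ε 1) + b (ε 0 - ε 1) (ε 0 - ε 1) := by
  have h1 := h.form_theta_alpha hN
  have h2 := h.form.symm (ε 0) (ε 1)
  simp only [h.form.add_left, h.form.sub_left, h.form.add_right, h.form.sub_right] at *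
  constructor <;> linarith

lemma form_zero_add {k : ℕ} {η : V} (hη : η ∈ signedEps ε N k) :
    4 * b (ε 0 + η) (ε 0 + η) = b (ε 0 + ε 1) (ε 0 + ε 1) +
      (1 + 2 * 𝔮 η) * b (ε 0 - ε 1) (ε 0 - ε 1) + 4 * b η η := by
  have hN : 3 ≤ N := by have := hη.1; have := hη.2.1; omega
  have h1 := h.form_zero_signed hη
  have h2 := (h.form_zero_zero hN).1
  have h3 := h.form.pairing_mul (h.alpha_mem hN) η
  have h4 := h.form.symm η (ε 0)
  rw [h.form.add_left, h.form.add_right, h.form.add_right]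
  linarith

lemma form_one_add {k : ℕ} {η : V} (hη : η ∈ signedEps ε N k) :
    4 * b (ε 1 + η) (ε 1 + η) = b (ε 0 + ε 1) (ε 0 + ε 1) +
      (1 - 2 * 𝔮 η) * b (ε 0 - ε 1) (ε 0 - ε 1) + 4 * b η η := by
  have hN : 3 ≤ N := by have := hη.1; have := hη.2.1; omega
  have h1 := h.form_one_signed hη
  have h2 := (h.form_zero_zero hN).2
  have h3 := h.form.pairing_mul (h.alpha_mem hN) η
  have h4 := h.form.symm η (ε 1)
  rw [h.form.add_left, h.form.add_right, h.form.add_right]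
  linarith

/-- Squared lengths of roots pairing to `1` with the highest root. -/
lemma exists_theta_length (hN : 3 ≤ N) {γ : V} (hγ : γ ∈ R) (hf : 𝔣 γ = 1) :
    ∃ z : ℤ, 1 ≤ z ∧ z ≤ 3 ∧ z * b γ γ = b (ε 0 + ε 1) (ε 0 + ε 1) := by
  have hθ := h.theta_mem hN
  obtain ⟨z, hz, -⟩ := h.form.reflection γ hγ _ hθ
  have h1 := h.form.pairing_mul hθ γ
  rw [hf, h.form.symm _ γ, hz, one_mul] at h1
  have h2 : 0 < b (γ + γ - (ε 0 + ε 1)) (γ + γ - (ε 0 + ε 1)) := by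
    refine h.form.pos _ ?_ fun h0 => ?_
    · have := AddSubgroup.subset_closure (k := R) hγ
      exact sub_mem (add_mem this this) (AddSubgroup.subset_closure hθ)
    · exact h.form.add_self_notMem γ hγ (sub_eq_zero.1 h0 ▸ hθ)
  have h3 := h.form.self_pos hγ
  have h4 := h.form.self_pos hθ
  rw [h.form.sub_left, h.form.sub_right, h.form.sub_right, h.form.add_left, h.form.add_left,
    h.form.add_right, h.form.add_right _ γ, h.form.symm γ (ε 0 + ε 1)] at h2
  rw [h.form.symm γ] at hz
  have h5 : 0 < (4 - (z : ℝ)) * b γ γ := by linarith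
  have h6 : 0 < (z : ℝ) := by
    by_contra! hn
    nlinarith
  have h7 : 0 < 4 - (z : ℝ) := (pos_iff_pos_of_mul_pos h5).2 h3
  refine ⟨z, by exact_mod_cast h6, ?_, h1.symm⟩
  have : (z : ℝ) < 4 := by linarith
  have : z < 4 := by exact_mod_cast this
  omega

/-- Squared lengths of roots pairing to `1` with the highest root and to `m` with
`ε 0 - ε 1`. -/
lemma exists_alpha_length (hN : 3 ≤ N) {γ : V} (hγ : γ ∈ R) (hf : 𝔣 γ = 1) {m : ℤ} (hm : 0 < m)
    (hq : 𝔮 γ = m) : ∃ z : ℤ, 1 ≤ z ∧ m * z ≤ 3 ∧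
      z * b γ γ = m * b (ε 0 - ε 1) (ε 0 - ε 1) := by
  have hα := h.alpha_mem hN
  obtain ⟨z, hz, -⟩ := h.form.reflection γ hγ _ hα
  have h1 := h.form.pairing_mul hα γ
  rw [hq, h.form.symm _ γ, hz] at h1
  have hf' : 𝔣 (γ + γ - m • (ε 0 - ε 1)) = 2 := by
    obtain ⟨e0, e1, -⟩ := h.pairing_theta_eps hN
    rw [map_sub, map_add, map_zsmul, map_sub, e0, e1, hf]
    norm_num
  have hmem : γ + γ - m • (ε 0 - ε 1) ∈ AddSubgroup.closure R := by
    have := AddSubgroup.subset_closure (k := R) hγ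
    exact sub_mem (add_mem this this) (zsmul_mem (AddSubgroup.subset_closure hα) _)
  have h2 := h.form.pos _ hmem (by
    intro h0
    rw [h0, map_zero] at hf'
    norm_num at hf')
  have hzl (x : V) : b (m • (ε 0 - ε 1)) x = m * b (ε 0 - ε 1) x := by
    simpa using map_zsmul
      (AddMonoidHom.mk' (fun y => b y x) fun y z => h.form.add_left y z x) m (ε 0 - ε 1)
  have h3 := h.form.self_pos hγ
  have h4 := h.form.self_pos hα
  have hm' : (0 : ℝ) < m := by exact_mod_cast hm
  rw [h.form.sub_left, h.form.sub_right, h.form.sub_right, hzl, hzl, h.form.symm _ (m • _),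
    h.form.symm (ε 0 - ε 1) (m • _), hzl, hzl, h.form.add_left, h.form.add_right _ γ γ,
    h.form.add_right _ γ γ] at h2
  rw [h.form.symm γ] at hz
  have h6 : 0 < (z : ℝ) := by
    by_contra! hn
    have := mul_pos hm' h4
    nlinarith
  have h5 : 0 < (4 - m * (z : ℝ)) * b γ γ := by
    have : m * (z : ℝ) * b γ γ = m * (m * b (ε 0 - ε 1) (ε 0 - ε 1)) := by rw [h1]; ring
    linear_combination h2 - this - 2 * m * hz
  have h7 : 0 < 4 - m * (z : ℝ) := (pos_iff_pos_of_mul_pos h5).2 h3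
  refine ⟨z, by exact_mod_cast h6, ?_, h1.symm⟩
  have : (m * z : ℝ) < 4 := by linarith
  have : m * z < 4 := by exact_mod_cast this
  omega

end IsTypeDLevel
end TypeD

section TypeD

variable {V : Type*} [AddCommGroup V] {R : Set V} {b : V → V → ℝ}

lemma eq_or_eq_neg_of_mem_signedEps {ε : ℕ → V} {N k : ℕ} {η η' : V}
    (hη : η ∈ signedEps ε N k) (hη' : η' ∈ signedEps ε N k) : η' = η ∨ η' = -η := by
  obtain ⟨-, -, rfl | rfl⟩ := hη <;> obtain ⟨-, -, rfl | rfl⟩ := hη' <;> simp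

namespace IsTypeDLevel

variable {ht : V →+ ℝ} {ε : ℕ → V} {N : ℕ} (h : IsTypeDLevel R b ht ε N)
include h

local notation "𝔣" => IsRootForm.pairing (IsTypeDLevel.form h) (ε 0 + ε 1)
local notation "𝔮" => IsRootForm.pairing (IsTypeDLevel.form h) (ε 0 - ε 1)

lemma zero_add_signed_mem {k : ℕ} {η : V} (hη : η ∈ signedEps ε N k) :
    ε 0 + η ∈ R ∧ 𝔣 (ε 0 + η) = 1 := by
  refine ⟨h.dRoots_subset (eps_add_mem_dRoots (by omega) hη), ?_⟩
  rw [map_add, h.pairing_theta_signed hη, (h.pairing_theta_eps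
    (by have := hη.1; have := hη.2.1; omega)).1, add_zero]

lemma one_add_signed_mem {k : ℕ} {η : V} (hη : η ∈ signedEps ε N k) :
    ε 1 + η ∈ R ∧ 𝔣 (ε 1 + η) = 1 := by
  refine ⟨h.dRoots_subset (eps_add_mem_dRoots (by omega) hη), ?_⟩
  rw [map_add, h.pairing_theta_signed hη, (h.pairing_theta_eps
    (by have := hη.1; have := hη.2.1; omega)).2.1, add_zero]

lemma pairing_theta_alpha (hN : 3 ≤ N) : 𝔣 (ε 0 - ε 1) = 0 := by
  obtain ⟨e0, e1, -⟩ := h.pairing_theta_eps hN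
  rw [map_sub, e0, e1, sub_self]

lemma signed_add_self_mem_closure {k : ℕ} {η : V} (hη : η ∈ signedEps ε N k) :
    η + η ∈ AddSubgroup.closure R := by
  have := sub_mem (AddSubgroup.subset_closure (h.zero_add_signed_mem hη).1)
    (AddSubgroup.subset_closure (h.zero_add_signed_mem (neg_mem_signedEps hη)).1)
  convert this using 1
  abel

lemma exists_pairing_alpha_signed {k : ℕ} {η : V} (hη : η ∈ signedEps ε N k) :
    ∃ z : ℤ, 𝔮 η = z := by
  have hN : 3 ≤ N := by have := hη.1; have := hη.2.1; omega
  obtain ⟨z, hz, -⟩ := h.form.exists_pairing_eq (h.alpha_mem hN) (h.zero_add_signed_mem hη).1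
  rw [map_add, (h.pairing_alpha_eps hN).1] at hz
  exact ⟨z - 1, by push_cast; linarith⟩

lemma pairing_alpha_signed_pos {k : ℕ} {η : V} (hη : η ∈ signedEps ε N k) (hq : 0 < 𝔮 η) :
    (𝔮 η = 1 ∧ b (ε 0 + ε 1) (ε 0 + ε 1) = 2 * b (ε 0 - ε 1) (ε 0 - ε 1) ∧
      4 * b η η = 3 * b (ε 0 - ε 1) (ε 0 - ε 1)) ∨
    (𝔮 η = 2 ∧ b (ε 0 + ε 1) (ε 0 + ε 1) = 3 * b (ε 0 - ε 1) (ε 0 - ε 1) ∧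
      b η η = b (ε 0 - ε 1) (ε 0 - ε 1)) := by
  have hN : 3 ≤ N := by have := hη.1; have := hη.2.1; omega
  obtain ⟨s, hs⟩ := h.exists_pairing_alpha_signed hη
  have hs0 : 0 < s := by rw [hs] at hq; exact_mod_cast hq
  obtain ⟨h0, h0f⟩ := h.zero_add_signed_mem hη
  obtain ⟨h1, h1f⟩ := h.one_add_signed_mem hη
  obtain ⟨z, hz1, hz3, hz⟩ := h.exists_alpha_length hN h0 h0f (m := s + 1) (by omega)
    (by rw [map_add, (h.pairing_alpha_eps hN).1, hs]; push_cast; ring)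
  obtain ⟨z0, hz01, hz03, hz0⟩ := h.exists_theta_length hN h0 h0f
  obtain ⟨z1, hz11, hz13, hz1'⟩ := h.exists_theta_length hN h1 h1f
  have e0 := h.form_zero_add hη
  have e1 := h.form_one_add hη
  have hM := h.form.self_pos (h.alpha_mem hN)
  obtain rfl : z = 1 := by nlinarith
  rw [hs] at e0 e1 ⊢
  rw [Int.cast_one, one_mul] at hz
  have hs2 : s = 1 ∨ s = 2 := by omega
  have hG : b (ε 1 + η) (ε 1 + η) = b (ε 0 - ε 1) (ε 0 - ε 1) := by
    rw [hz] at e0; push_cast at e0; linarith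
  rw [hG, ← hz0, hz] at hz1'
  rw [hz] at hz0 e0
  rcases hs2 with rfl | rfl
  · left
    have : (z1 : ℝ) = z0 * 2 := by
      push_cast at hz1'
      exact mul_right_cancel₀ hM.ne' (by linarith)
    have : z1 = z0 * 2 := by exact_mod_cast this
    obtain rfl : z0 = 1 := by omega
    push_cast at *
    refine ⟨rfl, by linarith, by linarith⟩
  · right
    have : (z1 : ℝ) = z0 * 3 := by
      push_cast at hz1'
      exact mul_right_cancel₀ hM.ne' (by linarith)
    have : z1 = z0 * 3 := by exact_mod_cast this
    obtain rfl : z0 = 1 := by omega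
    push_cast at *
    refine ⟨rfl, by linarith, by linarith⟩

lemma form_add_signed_of_pairing_eq_zero {k : ℕ} {η : V} (hη : η ∈ signedEps ε N k)
    (hq : 𝔮 η = 0) : ∃ z : ℤ, 1 ≤ z ∧ z ≤ 3 ∧
      z * (b (ε 0 + ε 1) (ε 0 + ε 1) + b (ε 0 - ε 1) (ε 0 - ε 1) + 4 * b η η) =
        4 * b (ε 0 - ε 1) (ε 0 - ε 1) := by
  have hN : 3 ≤ N := by have := hη.1; have := hη.2.1; omega
  obtain ⟨h0, h0f⟩ := h.zero_add_signed_mem hη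
  obtain ⟨z, hz1, hz3, hz⟩ := h.exists_alpha_length hN h0 h0f (m := 1) (by omega)
    (by rw [map_add, (h.pairing_alpha_eps hN).1, hq]; simp)
  have e0 := h.form_zero_add hη
  rw [hq] at e0
  refine ⟨z, hz1, by omega, ?_⟩
  rw [Int.cast_one, one_mul] at hz
  linear_combination 4 * hz - z * e0

lemma false_of_three_pairing_one {i j l : ℕ} {x y w : V} (hil : i ≠ l)
    (hjl : j ≠ l) (hx : x ∈ signedEps ε N i) (hy : y ∈ signedEps ε N j)
    (hw : w ∈ signedEps ε N l) (hqx : 𝔮 x = 1) (hqw : 𝔮 w = 1)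
    (hα : ε 0 - ε 1 = x + y) : False := by
  have hN : 3 ≤ N := by have := hx.1; have := hx.2.1; omega
  have hαR := h.alpha_mem hN
  have hM := h.form.self_pos hαR
  obtain ⟨-, hN0, hbx⟩ := (h.pairing_alpha_signed_pos hx (by linarith)).resolve_right
    fun h2 => by linarith [h2.1]
  obtain ⟨-, -, hbw⟩ := (h.pairing_alpha_signed_pos hw (by linarith)).resolve_right
    fun h2 => by linarith [h2.1]
  have hγ := h.signed_add_mem hx hw hil
  have hδ := (h.zero_add_signed_mem hw).1
  have hsub := h.form.self_pos (h.signed_sub_mem hw hy hjl.symm)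
  have hwy : w - y = (x + w) - (ε 0 - ε 1) := by rw [hα]; abel
  have hax := h.form.pairing_mul hαR x
  have haw := h.form.pairing_mul hαR w
  have h0x := h.form_zero_signed hx
  have h0w := h.form_zero_signed hw
  obtain ⟨z, hz, -⟩ := h.form.reflection _ hγ _ hαR
  obtain ⟨z', hz', -⟩ := h.form.reflection _ hγ _ hδ
  have e0 := h.form_zero_add hw
  have hsx := h.form.symm x (ε 0 - ε 1)
  have hsw := h.form.symm w (ε 0 - ε 1)
  have hxw := h.form.symm x w
  have hs0x := h.form.symm x (ε 0)
  have hs0w := h.form.symm w (ε 0)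
  rw [hqx] at hax
  rw [hqw] at haw
  rw [hwy, h.form.sub_left (x + w), h.form.sub_right (x + w), h.form.sub_right (ε 0 - ε 1),
    h.form.add_right (ε 0 - ε 1), h.form.add_left x w (ε 0 - ε 1)] at hsub
  rw [h.form.add_left x w (ε 0 - ε 1)] at hz
  have hz1 : (z : ℝ) * b (x + w) (x + w) = 2 * b (ε 0 - ε 1) (ε 0 - ε 1) := by linarith
  have hgt : b (ε 0 - ε 1) (ε 0 - ε 1) < b (x + w) (x + w) := by linarith
  have hzp : (0 : ℝ) < z := by
    by_contra! hn
    nlinarith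
  have hz2 : (z : ℝ) < 2 := by
    by_contra! hn
    nlinarith
  obtain rfl : z = 1 := by
    have h1 : 0 < z := by exact_mod_cast hzp
    have h2 : z < 2 := by exact_mod_cast hz2
    omega
  rw [Int.cast_one, one_mul] at hz1
  rw [hz1] at hz'
  rw [h.form.add_left, h.form.add_right, h.form.add_right] at hz1 hz'
  have : (3 : ℝ) = 2 * z' := mul_right_cancel₀ hM.ne' (by linarith)
  have : (3 : ℤ) = 2 * z' := by exact_mod_cast this
  omega

variable [IsAddTorsionFree V]

omit h in
lemma eq_zero_of_form_nonpos (hb : IsRootForm R b) {x : V}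
    (hx : x + x ∈ AddSubgroup.closure R) (h0 : b x x ≤ 0) : x = 0 := by
  by_contra hne
  have := hb.pos _ hx fun h => hne (self_eq_neg.1 (eq_neg_of_add_eq_zero_left h))
  rw [hb.add_left, hb.add_right] at this
  linarith

lemma form_signed_nonneg {k : ℕ} {η : V} (hη : η ∈ signedEps ε N k) : 0 ≤ b η η := by
  by_contra! hn
  have := eq_zero_of_form_nonpos h.form (h.signed_add_self_mem_closure hη) hn.le
  rw [this, h.form.zero_left] at hn
  exact hn.false

lemma alpha_eq_of_pairing_pos {k : ℕ} {η : V} (hη : η ∈ signedEps ε N k) (hq : 0 < 𝔮 η) :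
    η = ε 0 - ε 1 ∨ ∃ j ≠ k, ∃ η' ∈ signedEps ε N j, ε 0 - ε 1 = η - η' := by
  have hN : 3 ≤ N := by have := hη.1; have := hη.2.1; omega
  have hα := h.alpha_mem hN
  have hα0 := h.form.ne_zero hα
  obtain ⟨h0, h0f⟩ := h.zero_add_signed_mem hη
  obtain ⟨h1, h1f⟩ := h.one_add_signed_mem hη
  have hfα := h.pairing_theta_alpha hN
  have hρ : ε 1 + η - (ε 0 - ε 1) ∈ R := by
    rcases h.pairing_alpha_signed_pos hη hq with ⟨hq1, -⟩ | ⟨hq2, -⟩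
    · obtain ⟨z, hz, hzR⟩ := h.form.exists_pairing_eq hα h0
      rw [map_add, hq1, (h.pairing_alpha_eps hN).1] at hz
      obtain rfl : z = 2 := by
        have : (z : ℝ) = 2 := by linarith
        exact_mod_cast this
      convert hzR using 1
      rw [two_smul]
      abel
    · refine h.form.sub_mem_of_pairing_pos hα h1 ?_ ?_
      · rw [map_add, hq2, (h.pairing_alpha_eps hN).2]; norm_num
      · intro he
        rw [← he, hfα] at h1f
        norm_num at h1f
  obtain ⟨j, η', hη', he⟩ := h.exists_of_pairing_eq_one hN hρ (by
    rw [map_sub, h1f, hfα, sub_zero])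
  rcases he with he | he
  · have he2 : η - η' = (ε 0 - ε 1) + (ε 0 - ε 1) := by
      rw [← sub_eq_zero] at he ⊢
      rw [← he]
      abel
    by_cases hjk : j = k
    · subst hjk
      rcases eq_or_eq_neg_of_mem_signedEps hη hη' with rfl | rfl
      · rw [sub_self] at he2
        exact absurd (self_eq_neg.1 (eq_neg_of_add_eq_zero_left he2.symm)) hα0
      · left
        rw [sub_neg_eq_add, ← two_nsmul, ← two_nsmul] at he2
        exact nsmul_right_injective two_ne_zero he2
    · refine absurd (h.signed_sub_mem hη hη' (Ne.symm hjk)) ?_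
      rw [he2]
      exact h.form.add_self_notMem _ hα
  · have he2 : ε 0 - ε 1 = η - η' := by
      rw [← sub_eq_zero] at he ⊢
      rw [← neg_eq_zero, ← he]
      abel
    by_cases hjk : j = k
    · subst hjk
      rcases eq_or_eq_neg_of_mem_signedEps hη hη' with rfl | rfl
      · rw [sub_self] at he2
        exact absurd he2 hα0
      · refine absurd (h.theta_mem hN) ?_
        have : ε 0 + ε 1 = (ε 1 + η) + (ε 1 + η) := by
          rw [← sub_add_cancel (ε 0) (ε 1), he2]
          abel
        rw [this]
        exact h.form.add_self_notMem _ h1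
    · exact Or.inr ⟨j, hjk, η', hη', he2⟩

lemma pairing_alpha_signed_ne_two (hN : 5 ≤ N) {k : ℕ} {η : V} (hη : η ∈ signedEps ε N k) :
    𝔮 η ≠ 2 := by
  intro hq
  have hα := h.alpha_mem (by omega)
  have hM := h.form.self_pos hα
  have hsign : ∀ {l : ℕ} {η : V}, η ∈ signedEps ε N l → 𝔮 η = 2 →
      b (ε 0 + ε 1) (ε 0 + ε 1) = 3 * b (ε 0 - ε 1) (ε 0 - ε 1) ∧ η = ε 0 - ε 1 := by
    intro l η hη hq
    rcases h.pairing_alpha_signed_pos hη (by linarith) with ⟨h1, -⟩ | ⟨-, h2, h3⟩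
    · linarith
    refine ⟨h2, sub_eq_zero.1 (eq_zero_of_form_nonpos h.form ?_ ?_)⟩
    · have := sub_mem (h.signed_add_self_mem_closure hη)
        (add_mem (AddSubgroup.subset_closure hα) (AddSubgroup.subset_closure hα))
      convert this using 1
      abel
    · have h4 := h.form.pairing_mul hα η
      rw [hq] at h4
      rw [h.form.sub_left _ _ (η - _), h.form.sub_right η, h.form.sub_right (ε 0 - ε 1) η,
        h.form.symm η (ε 0 - ε 1)]
      linarith
  obtain ⟨hN0, hηα⟩ := hsign hη hq
  have hzero : ∀ l, 2 ≤ l → l < N → l ≠ k → ε l = 0 := by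
    intro l hl2 hlN hlk
    have hl : ε l ∈ signedEps ε N l := ⟨hl2, hlN, Or.inl rfl⟩
    have hpos : ∀ {η' : V}, η' ∈ signedEps ε N l → ¬ 0 < 𝔮 η' := by
      intro η' hη' hp
      rcases h.pairing_alpha_signed_pos hη' hp with ⟨-, h1, -⟩ | ⟨h1, -⟩
      · linarith
      · exact h.signed_ne hη' hη hlk ((hsign hη' h1).2.trans hηα.symm)
    have h1 := hpos hl
    have h2 := hpos (neg_mem_signedEps hl)
    rw [map_neg] at h2
    obtain ⟨z, hz1, -, hz⟩ := h.form_add_signed_of_pairing_eq_zero hl (by linarith)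
    refine eq_zero_of_form_nonpos h.form (h.signed_add_self_mem_closure hl) ?_
    by_contra! hp
    have hz1' : (1 : ℝ) ≤ z := by exact_mod_cast hz1
    rw [hN0] at hz
    nlinarith
  have hz2 := hzero 2 le_rfl (by omega)
  have hz3 := hzero 3 (by omega) (by omega)
  have hz4 := hzero 4 (by omega) (by omega)
  have : k ≠ 2 ∧ k ≠ 3 ∨ k ≠ 2 ∧ k ≠ 4 ∨ k ≠ 3 ∧ k ≠ 4 := by omega
  rcases this with h1 | h1 | h1
  · exact absurd (h.inj 2 (by omega) 3 (by omega) (by rw [hz2 h1.1.symm, hz3 h1.2.symm])) (by simp)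
  · exact absurd (h.inj 2 (by omega) 4 (by omega) (by rw [hz2 h1.1.symm, hz4 h1.2.symm])) (by simp)
  · exact absurd (h.inj 3 (by omega) 4 (by omega) (by rw [hz3 h1.1.symm, hz4 h1.2.symm])) (by simp)

lemma pairing_alpha_signed_cases (hN : 5 ≤ N) {k : ℕ} {η : V} (hη : η ∈ signedEps ε N k) :
    𝔮 η = 0 ∨ 𝔮 η = 1 ∨ 𝔮 η = -1 := by
  have hpos : ∀ {η : V}, η ∈ signedEps ε N k → 0 < 𝔮 η → 𝔮 η = 1 := by
    intro η hη hq
    rcases h.pairing_alpha_signed_pos hη hq with h1 | h1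
    · exact h1.1
    · exact absurd h1.1 (h.pairing_alpha_signed_ne_two hN hη)
  rcases lt_trichotomy (𝔮 η) 0 with h1 | h1 | h1
  · have := hpos (neg_mem_signedEps hη) (by rw [map_neg]; linarith)
    rw [map_neg] at this
    exact Or.inr (Or.inr (by linarith))
  · exact Or.inl h1
  · exact Or.inr (Or.inl (hpos hη h1))

lemma four_mul_form_signed {k : ℕ} {η : V} (hη : η ∈ signedEps ε N k) (hq : 𝔮 η = 0)
    (hN0 : b (ε 0 + ε 1) (ε 0 + ε 1) = 2 * b (ε 0 - ε 1) (ε 0 - ε 1)) :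
    4 * b η η = b (ε 0 - ε 1) (ε 0 - ε 1) := by
  have hM := h.form.self_pos (h.alpha_mem (by have := hη.1; have := hη.2.1; omega))
  obtain ⟨z, hz1, hz3, hz⟩ := h.form_add_signed_of_pairing_eq_zero hη hq
  have hnn := h.form_signed_nonneg hη
  rw [hN0] at hz
  obtain rfl : z = 1 := by
    by_contra hne
    have : (2 : ℝ) ≤ z := by exact_mod_cast (by omega : 2 ≤ z)
    nlinarith
  rw [Int.cast_one, one_mul] at hz
  linarith

lemma false_of_add_self_eq {l i j : ℕ} {w x y : V} (hw : w ∈ signedEps ε N l)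
    (hx : x ∈ signedEps ε N i) (hy : y ∈ signedEps ε N j) (hqw : 𝔮 w = 0)
    (hqx : 𝔮 x = 1) (hqy : 𝔮 y = -1) (he : w + w = x + y) : False := by
  have hN : 3 ≤ N := by have := hx.1; have := hx.2.1; omega
  have hαR := h.alpha_mem hN
  have hM := h.form.self_pos hαR
  obtain ⟨-, hN0, hbx⟩ := (h.pairing_alpha_signed_pos hx (by linarith)).resolve_right
    fun h2 => by linarith [h2.1]
  have hqy' : 𝔮 (-y) = 1 := by rw [map_neg, hqy, neg_neg]
  obtain ⟨-, -, hby⟩ := (h.pairing_alpha_signed_pos (neg_mem_signedEps hy)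
    (by linarith)).resolve_right fun h2 => by linarith [h2.1]
  rw [h.form.neg_left, h.form.neg_right, neg_neg] at hby
  have hbw := h.four_mul_form_signed hw hqw hN0
  have hli : l ≠ i := by
    rintro rfl
    rcases eq_or_eq_neg_of_mem_signedEps hw hx with rfl | rfl
    · linarith
    · rw [map_neg] at hqx; linarith
  have hγ := h.signed_add_mem hw hx hli
  have h1 : b (w + w) (w + w) = b (x + y) (x + y) := by rw [he]
  have h2 : b (w + w) x = b (x + y) x := by rw [he]
  obtain ⟨z, hz, -⟩ := h.form.reflection _ hγ _ hαR
  have h3 := h.form.pairing_mul hαR (w + x)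
  rw [map_add, hqw, hqx, h.form.symm _ (w + x), hz] at h3
  have h4 := h.form.symm x y
  have h5 := h.form.symm x w
  simp only [h.form.add_left _ _ w, h.form.add_left _ _ x, h.form.add_left _ _ y,
    h.form.add_right] at h1 h2 h3
  have : (2 : ℝ) = 3 * z := by
    refine mul_right_cancel₀ hM.ne' ?_
    have : b w w + b x w + (b w x + b x x) = 3 / 2 * b (ε 0 - ε 1) (ε 0 - ε 1) := by linarith
    rw [this] at h3
    linarith
  have : (2 : ℤ) = 3 * z := by exact_mod_cast this
  omega

lemma pairing_alpha_signed_ne_one (hN : 5 ≤ N) {k : ℕ} {η : V} (hη : η ∈ signedEps ε N k) :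
    𝔮 η ≠ 1 := by
  intro hq
  have hN3 : 3 ≤ N := by omega
  have hαR := h.alpha_mem hN3
  have hM := h.form.self_pos hαR
  obtain ⟨-, hN0, -⟩ := (h.pairing_alpha_signed_pos hη (by linarith)).resolve_right
    fun h2 => by linarith [h2.1]
  have hqα := h.form.pairing_self hαR
  rcases h.alpha_eq_of_pairing_pos hη (by linarith) with rfl | ⟨j, hjk, η', hη', hα⟩
  · linarith
  have hα' : ε 0 - ε 1 = η + -η' := by rw [hα, sub_eq_add_neg]
  obtain ⟨l, hl2, hlN, hlk, hlj⟩ : ∃ l, 2 ≤ l ∧ l < N ∧ l ≠ k ∧ l ≠ j := by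
    by_cases h2 : 2 ≠ k ∧ 2 ≠ j
    · exact ⟨2, le_rfl, by omega, h2⟩
    by_cases h3 : 3 ≠ k ∧ 3 ≠ j
    · exact ⟨3, by omega, by omega, h3⟩
    · exact ⟨4, by omega, by omega, by omega, by omega⟩
  have hl : ε l ∈ signedEps ε N l := ⟨hl2, hlN, Or.inl rfl⟩
  rcases h.pairing_alpha_signed_cases hN hl with hql | hql | hql
  · have hbw := h.four_mul_form_signed hl hql hN0
    have hx := (h.zero_add_signed_mem hl).1
    have hy := (h.zero_add_signed_mem (neg_mem_signedEps hl)).1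
    have hb0 := (h.form_zero_zero hN3).1
    have hxx := h.form_zero_add hl
    have hxy : b (ε 0 + -ε l) (ε 0 + ε l) = b (ε 0) (ε 0) - b (ε l) (ε l) := by
      rw [h.form.add_left, h.form.add_right, h.form.add_right, h.form.neg_left, h.form.neg_left,
        h.form.symm (ε l)]
      ring
    rw [hql] at hxx
    have hρ := h.form.sub_mem _ hy _ hx (by rw [hxy]; linarith) (by
      intro he
      rw [he] at hxy
      linarith)
    rw [show ε 0 + ε l - (ε 0 + -ε l) = ε l + ε l by abel] at hρ
    have hD : ε l + ε l ∈ dRoots ε N ∨ -(ε l + ε l) ∈ dRoots ε N := by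
      have hpx := h.ht_pos _ (eps_add_mem_dRoots (i := 0) (by omega) hl)
      have hpy := h.ht_pos _ (eps_add_mem_dRoots (i := 0) (by omega) (neg_mem_signedEps hl))
      by_cases hp : 0 < ht (ε l + ε l)
      · refine Or.inl (h.sum _ hy _ hρ hpy hp ?_).2.1
        convert hx using 1; abel
      · obtain ⟨h1, h2⟩ := h.ht_neg hρ hp
        refine Or.inr (h.sum _ hx _ h1 hpx h2 ?_).2.1
        convert hy using 1; abel
    have hfl := h.pairing_theta_signed hl
    obtain ⟨i, m, him, x, hxi, y, hym, he⟩ : ∃ i m, i ≠ m ∧ ∃ x ∈ signedEps ε N i,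
        ∃ y ∈ signedEps ε N m, ε l + ε l = x + y := by
      rcases hD with hD | hD
      · rcases h.eq_of_pairing_eq_zero hN3 hD (by rw [map_add, hfl, add_zero]) with
          he | ⟨i, m, hi, him, hm, he | he⟩
        · have := congrArg 𝔮 he
          rw [map_add, hql, hqα] at this
          linarith
        · exact ⟨i, m, him.ne, ε i, ⟨hi, by omega, Or.inl rfl⟩, ε m, ⟨by omega, hm, Or.inl rfl⟩, he⟩
        · exact ⟨i, m, him.ne, ε i, ⟨hi, by omega, Or.inl rfl⟩, -ε m, ⟨by omega, hm, Or.inr rfl⟩,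
            he.trans (sub_eq_add_neg _ _)⟩
      · rcases h.eq_of_pairing_eq_zero hN3 hD (by rw [map_neg, map_add, hfl, add_zero, neg_zero])
          with he | ⟨i, m, hi, him, hm, he | he⟩
        · have := congrArg 𝔮 he
          rw [map_neg, map_add, hql, hqα] at this
          linarith
        · exact ⟨i, m, him.ne, -ε i, ⟨hi, by omega, Or.inr rfl⟩, -ε m,
            ⟨by omega, hm, Or.inr rfl⟩, by rw [← neg_neg (ε l + ε l), he]; abel⟩
        · exact ⟨i, m, him.ne, -ε i, ⟨hi, by omega, Or.inr rfl⟩, ε m,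
            ⟨by omega, hm, Or.inl rfl⟩, by rw [← neg_neg (ε l + ε l), he]; abel⟩
    have hqe : 𝔮 x + 𝔮 y = 0 := by rw [← map_add, ← he, map_add, hql, add_zero]
    rcases h.pairing_alpha_signed_cases hN hxi with hqx | hqx | hqx
    · have h1 := h.four_mul_form_signed hxi hqx hN0
      have h2 := h.four_mul_form_signed hym (by linarith) hN0
      have h3 := h.form.self_pos (h.signed_sub_mem hxi hym him)
      have h4 : b (ε l + ε l) (ε l + ε l) = b (x + y) (x + y) := by rw [he]
      rw [h.form.sub_left, h.form.sub_right, h.form.sub_right] at h3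
      rw [h.form.add_left x, h.form.add_right x, h.form.add_right y, h.form.add_left,
        h.form.add_right] at h4
      linarith
    · exact h.false_of_add_self_eq hl hxi hym hql hqx (by linarith) he
    · exact h.false_of_add_self_eq hl hym hxi hql (by linarith) hqx (by rw [he, add_comm])
  · exact h.false_of_three_pairing_one hlk.symm hlj.symm hη (neg_mem_signedEps hη') hl
      hq hql hα'
  · exact h.false_of_three_pairing_one hlk.symm hlj.symm hη (neg_mem_signedEps hη')
      (neg_mem_signedEps hl) hq (by rw [map_neg, hql, neg_neg]) hα'

lemma pairing_alpha_signed (hN : 5 ≤ N) {k : ℕ} {η : V} (hη : η ∈ signedEps ε N k) :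
    𝔮 η = 0 := by
  rcases h.pairing_alpha_signed_cases hN hη with h1 | h1 | h1
  · exact h1
  · exact absurd h1 (h.pairing_alpha_signed_ne_one hN hη)
  · refine absurd ?_ (h.pairing_alpha_signed_ne_one hN (neg_mem_signedEps hη))
    rw [map_neg, h1, neg_neg]

end IsTypeDLevel
end TypeD

section TypeD

variable {V L : Type*} [AddCommGroup V] [LieRing L] [LieAlgebra ℂ L]
  {R : Set V} {b : V → V → ℝ} {e : V → L}

lemma IsRootForm.inter_ker (h : IsRootForm R b) (f : V →+ ℝ) :
    IsRootForm {γ | γ ∈ R ∧ f γ = 0} b where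
  add_left := h.add_left
  symm := h.symm
  pos x hx := h.pos x (AddSubgroup.closure_mono (fun _ hγ => hγ.1) hx)
  reflection α hα β hβ := by
    obtain ⟨z, hz, hzR⟩ := h.reflection α hα.1 β hβ.1
    exact ⟨z, hz, hzR, by rw [map_sub, map_zsmul, hα.2, hβ.2, smul_zero, sub_zero]⟩
  sub_mem α hα β hβ hp hne :=
    ⟨h.sub_mem α hα.1 β hβ.1 hp hne, by rw [map_sub, hα.2, hβ.2, sub_zero]⟩
  neg_mem α hα := ⟨h.neg_mem α hα.1, by rw [map_neg, hα.2, neg_zero]⟩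
  zero_notMem h0 := h.zero_notMem h0.1
  add_self_notMem α hα h2 := h.add_self_notMem α hα.1 h2.1

lemma IsRootVectors.inter_ker (he : IsRootVectors R e) (f : V →+ ℝ) :
    IsRootVectors {γ | γ ∈ R ∧ f γ = 0} e where
  indep := he.indep.mono fun _ hγ => hγ.1
  lie_mem α hα β hβ h := he.lie_mem α hα.1 β hβ.1 h.1
  lie_zero α hα β hβ h h0 :=
    he.lie_zero α hα.1 β hβ.1 (fun hR => h ⟨hR, by rw [map_add, hα.2, hβ.2, add_zero]⟩) h0

lemma IsCommPol.mono {R' : Set V} {C Q : Finset V} (h : IsCommPol R e C Q) (hR : R' ⊆ R) :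
    IsCommPol R' e C Q :=
  ⟨h.subset, fun γ hγ δ hδ hm => h.comm γ hγ δ hδ (hR hm), h.le⟩

/-- A set `Q` of positive roots such that a sum of two positive roots lies in `Q` if and only if
one of the summands does. -/
structure IsNilradical (R : Set V) (ht : V →+ ℝ) (Q : Finset V) : Prop where
  subset : (Q : Set V) ⊆ R
  pos : ∀ γ ∈ Q, 0 < ht γ
  add_mem : ∀ γ ∈ Q, ∀ δ ∈ R, 0 < ht δ → γ + δ ∈ R → γ + δ ∈ Q
  mem_or_mem : ∀ γ ∈ R, ∀ δ ∈ R, 0 < ht γ → 0 < ht δ → γ + δ ∈ Q → γ ∈ Q ∨ δ ∈ Q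

lemma IsNilradical.filter_ker {ht : V →+ ℝ} {Q : Finset V} (h : IsNilradical R ht Q)
    (f : V →+ ℝ) : IsNilradical {γ | γ ∈ R ∧ f γ = 0} ht (Q.filter fun γ => f γ = 0) where
  subset γ hγ := by
    have := Finset.mem_filter.1 hγ
    exact ⟨h.subset this.1, this.2⟩
  pos γ hγ := h.pos γ (Finset.mem_filter.1 hγ).1
  add_mem γ hγ δ hδ hp hR :=
    Finset.mem_filter.2 ⟨h.add_mem γ (Finset.mem_filter.1 hγ).1 δ hδ.1 hp hR.1, hR.2⟩
  mem_or_mem γ hγ δ hδ hpγ hpδ hm := by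
    rw [Finset.mem_filter, Finset.mem_filter, and_iff_left hγ.2, and_iff_left hδ.2]
    exact h.mem_or_mem γ hγ.1 δ hδ.1 hpγ hpδ (Finset.mem_filter.1 hm).1

namespace IsTypeDLevel

variable {ht : V →+ ℝ} {ε : ℕ → V} {N : ℕ} (h : IsTypeDLevel R b ht ε N)
include h

local notation "𝔣" => IsRootForm.pairing (IsTypeDLevel.form h) (ε 0 + ε 1)
local notation "𝔮" => IsRootForm.pairing (IsTypeDLevel.form h) (ε 0 - ε 1)

lemma alpha_ne_signed_add_self {k : ℕ} {η : V} (hη : η ∈ signedEps ε N k) :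
    ε 0 - ε 1 ≠ η + η := by
  intro he
  refine h.form.add_self_notMem _ (h.one_add_signed_mem hη).1 ?_
  convert h.theta_mem (by have := hη.1; have := hη.2.1; omega) using 1
  rw [← sub_add_cancel (ε 0) (ε 1), he]
  abel

lemma pairing_alpha_of_mem [IsAddTorsionFree V] (hN : 5 ≤ N) {γ : V}
    (hγ : γ ∈ dRoots (fun i => ε (i + 2)) (N - 2)) : 𝔮 γ = 0 := by
  obtain ⟨i, j, hij, hj, hγ⟩ := hγ
  have hi := h.pairing_alpha_signed hN (k := i + 2) ⟨by omega, by omega, Or.inl rfl⟩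
  have hj := h.pairing_alpha_signed hN (k := j + 2) ⟨by omega, by omega, Or.inl rfl⟩
  rcases hγ with rfl | rfl
  · rw [map_add, hi, hj, add_zero]
  · rw [map_sub, hi, hj, sub_zero]

lemma mem_dRoots_shift {γ : V} (hN : 3 ≤ N) (hγ : γ ∈ dRoots ε N) (hf : 𝔣 γ = 0) :
    γ = ε 0 - ε 1 ∨ γ ∈ dRoots (fun i => ε (i + 2)) (N - 2) := by
  refine (h.eq_of_pairing_eq_zero hN hγ hf).imp_right ?_
  rintro ⟨i, j, hi, hij, hj, hγ⟩
  refine ⟨i - 2, j - 2, by omega, by omega, ?_⟩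
  simpa only [Nat.sub_add_cancel hi, Nat.sub_add_cancel (hi.trans hij.le)] using hγ

lemma sum_of_pairing_eq_zero [IsAddTorsionFree V] (hN : 5 ≤ N) {γ δ : V} (hγ : γ ∈ R)
    (hfγ : 𝔣 γ = 0) (hpγ : 0 < ht γ) (hδ : δ ∈ R) (hfδ : 𝔣 δ = 0) (hpδ : 0 < ht δ)
    (hR : γ + δ ∈ R) :
    γ ∈ dRoots (fun i => ε (i + 2)) (N - 2) ∧ δ ∈ dRoots (fun i => ε (i + 2)) (N - 2) ∧
      γ + δ ∈ dRoots (fun i => ε (i + 2)) (N - 2) := by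
  obtain ⟨h1, h2, h3⟩ := h.sum γ hγ δ hδ hpγ hpδ hR
  have hα := h.form.pairing_self (h.alpha_mem (by omega))
  have h1 := h.mem_dRoots_shift (by omega) h1 hfγ
  have h2 := h.mem_dRoots_shift (by omega) h2 hfδ
  have h3 := h.mem_dRoots_shift (by omega) h3 (by rw [map_add, hfγ, hfδ, add_zero])
  have key : ∀ ρ, (ρ = ε 0 - ε 1 ∨ ρ ∈ dRoots (fun i => ε (i + 2)) (N - 2)) →
      (ρ = ε 0 - ε 1 ∧ 𝔮 ρ = 2) ∨ (ρ ∈ dRoots (fun i => ε (i + 2)) (N - 2) ∧ 𝔮 ρ = 0) := by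
    rintro ρ (rfl | hρ)
    · exact Or.inl ⟨rfl, hα⟩
    · exact Or.inr ⟨hρ, h.pairing_alpha_of_mem hN hρ⟩
  have hadd := map_add 𝔮 γ δ
  rcases key _ h1 with ⟨h1, q1⟩ | ⟨h1, q1⟩ <;> rcases key _ h2 with ⟨h2, q2⟩ | ⟨h2, q2⟩ <;>
    rcases key _ h3 with ⟨h3, q3⟩ | ⟨h3, q3⟩ <;> rw [q1, q2, q3] at hadd <;>
    first
    | exact ⟨h1, h2, h3⟩
    | norm_num at hadd
  · rw [h1, add_eq_left] at h3
    exact absurd h3 (h.form.ne_zero hδ)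
  · rw [h2, add_eq_right] at h3
    exact absurd h3 (h.form.ne_zero hγ)

/-- The roots orthogonal to the highest root form a level with two fewer coordinates. -/
lemma shift [IsAddTorsionFree V] (hN : 5 ≤ N) :
    IsTypeDLevel {γ | γ ∈ R ∧ 𝔣 γ = 0} b ht (fun i => ε (i + 2)) (N - 2) where
  form := h.form.inter_ker _
  finite := h.finite.subset fun _ hγ => hγ.1
  inj i hi j hj he := by
    have := h.inj (i + 2) (by omega) (j + 2) (by omega) he
    omega
  dRoots_subset := by
    rintro γ ⟨i, j, hij, hj, hγ⟩
    have ek := (h.pairing_theta_eps (by omega)).2.2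
    have hi0 := ek (i + 2) (by omega) (by omega)
    have hj0 := ek (j + 2) (by omega) (by omega)
    refine ⟨h.dRoots_subset ⟨i + 2, j + 2, by omega, by omega, hγ⟩, ?_⟩
    rcases hγ with rfl | rfl
    · rw [map_add, hi0, hj0, add_zero]
    · rw [map_sub, hi0, hj0, sub_zero]
  ht_pos := by
    rintro γ ⟨i, j, hij, hj, hγ⟩
    exact h.ht_pos γ ⟨i + 2, j + 2, by omega, by omega, hγ⟩
  ht_ne γ hγ := h.ht_ne γ hγ.1
  sum γ hγ δ hδ hpγ hpδ hR := h.sum_of_pairing_eq_zero hN hγ.1 hγ.2 hpγ hδ.1 hδ.2 hpδ hR.1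

lemma add_notMem_of_eq_four (hN : N = 4) {γ δ : V} (hγ : γ ∈ R)
    (hfγ : 𝔣 γ = 0) (hpγ : 0 < ht γ) (hδ : δ ∈ R) (hfδ : 𝔣 δ = 0) (hpδ : 0 < ht δ) :
    γ + δ ∉ R := by
  intro hR
  obtain ⟨h1, h2, h3⟩ := h.sum γ hγ δ hδ hpγ hpδ hR
  have key : ∀ ρ ∈ dRoots ε N, 𝔣 ρ = 0 → ρ = ε 0 - ε 1 ∨ ρ = ε 2 + ε 3 ∨ ρ = ε 2 - ε 3 := by
    intro ρ hρ hf
    refine (h.eq_of_pairing_eq_zero (by omega) hρ hf).imp_right ?_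
    rintro ⟨i, j, hi, hij, hj, hρ⟩
    obtain rfl : i = 2 := by omega
    obtain rfl : j = 3 := by omega
    exact hρ
  have hne : γ ≠ δ := by
    rintro rfl
    exact h.form.add_self_notMem γ hγ hR
  have hγ0 := h.form.ne_zero hγ
  have hδ0 := h.form.ne_zero hδ
  have a2 := h.alpha_ne_signed_add_self (k := 2) ⟨by omega, by omega, Or.inl rfl⟩
  have a3 := h.alpha_ne_signed_add_self (k := 3) ⟨by omega, by omega, Or.inl rfl⟩
  have a3' := h.alpha_ne_signed_add_self (k := 3) ⟨by omega, by omega, Or.inr rfl⟩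
  have h1 := key _ h1 hfγ
  have h2 := key _ h2 hfδ
  have h3 := key _ h3 (by rw [map_add, hfγ, hfδ, add_zero])
  grind

lemma alpha_add_notMem [IsAddTorsionFree V] (hN : 4 ≤ N) {γ : V} (hγ : γ ∈ R)
    (hf : 𝔣 γ = 0) (hp : 0 < ht γ) : ε 0 - ε 1 + γ ∉ R := by
  have hα := h.alpha_mem (by omega)
  have hαf := h.pairing_theta_alpha (by omega)
  have hαp := h.ht_pos _ ⟨0, 1, by omega, by omega, Or.inr rfl⟩
  rcases hN.eq_or_lt with hN | hN
  · exact h.add_notMem_of_eq_four hN.symm hα hαf hαp hγ hf hp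
  · intro hR
    have h1 := h.pairing_alpha_of_mem hN (h.sum_of_pairing_eq_zero hN hα hαf hαp hγ hf hp hR).1
    rw [h.form.pairing_self hα] at h1
    norm_num at h1

lemma eps_two_add_mem (hN : 4 ≤ N) :
    ε 2 + ε 3 ∈ R ∧ 𝔣 (ε 2 + ε 3) = 0 ∧ 0 < ht (ε 2 + ε 3) := by
  have ek := (h.pairing_theta_eps (by omega)).2.2
  refine ⟨h.eps_add_eps_mem (by omega) (by omega), ?_,
    h.ht_pos _ ⟨2, 3, by omega, by omega, Or.inl rfl⟩⟩
  rw [map_add, ek 2 (by omega) (by omega), ek 3 (by omega) (by omega), add_zero]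

lemma eps_two_add_add_notMem [IsAddTorsionFree V] (hN : 4 ≤ N) {γ : V} (hγ : γ ∈ R)
    (hf : 𝔣 γ = 0) (hp : 0 < ht γ) : ε 2 + ε 3 + γ ∉ R := by
  obtain ⟨h1, h2, h3⟩ := h.eps_two_add_mem hN
  rcases hN.eq_or_lt with hN | hN
  · exact h.add_notMem_of_eq_four hN.symm h1 h2 h3 hγ hf hp
  · intro hR
    exact (h.shift hN).theta_add_notMem (by omega) ⟨hγ, hf⟩ hp
      ⟨hR, by rw [map_add, h2, hf, add_zero]⟩

variable {C Q : Finset V}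

lemma theta_mem_of_eps_add_mem (hQ : IsNilradical R ht Q) {k : ℕ} (hk : 2 ≤ k) (hkN : k + 1 < N)
    (hm : ε k + ε (k + 1) ∈ Q) : ε 0 + ε 1 ∈ Q := by
  have h1 := hQ.add_mem _ hm (ε 0 - ε k) (h.eps_sub_eps_mem (by omega) (by omega))
    (h.ht_pos _ ⟨0, k, by omega, by omega, Or.inr rfl⟩) (by
      convert h.eps_add_eps_mem (i := 0) (j := k + 1) (by omega) hkN using 1
      abel)
  rw [show ε k + ε (k + 1) + (ε 0 - ε k) = ε 0 + ε (k + 1) by abel] at h1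
  have h2 := hQ.add_mem _ h1 (ε 1 - ε (k + 1)) (h.eps_sub_eps_mem (by omega) hkN)
    (h.ht_pos _ ⟨1, k + 1, by omega, by omega, Or.inr rfl⟩) (by
      convert h.theta_mem (by omega) using 1
      abel)
  convert h2 using 1
  abel

lemma reduce (he : IsRootVectors R e) (hQ : IsNilradical R ht Q) (hC : IsCommPol R e C Q)
    (hN : 3 ≤ N) (hθ : ε 0 + ε 1 ∈ Q) :
    IsCommPol R e (C.filter fun γ => 𝔣 γ = 0) (Q.filter fun γ => 𝔣 γ = 0) ∧
      ∀ γ ∈ R, 𝔣 γ = 1 → γ ∈ C ∨ ε 0 + ε 1 - γ ∈ C := by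
  have hU : ∀ γ, γ ∈ h.finite.toFinset.filter (fun γ => 𝔣 γ = 1) ↔ γ ∈ R ∧ 𝔣 γ = 1 := by simp
  have hθ2 := h.form.pairing_self (h.theta_mem hN)
  have hσ : ∀ γ ∈ R, 𝔣 γ = 1 → ε 0 + ε 1 - γ ∈ R ∧ 𝔣 (ε 0 + ε 1 - γ) = 1 := by
    intro γ hγ hf
    refine ⟨(h.theta_sub_mem hN hγ (by rw [hf]; norm_num) ?_).1, ?_⟩
    · rintro rfl
      rw [hθ2] at hf
      norm_num at hf
    · rw [map_sub, hθ2, hf]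
      norm_num
  have hpos : ∀ γ ∈ R, 𝔣 γ = 1 → 0 < ht γ := fun γ hγ hf => h.pos_of_pairing_eq_one hN hγ hf
  refine And.imp_right (fun h2 γ hγ hf => h2 γ ((hU γ).2 ⟨hγ, hf⟩)) <|
    hC.reduce he (U := h.finite.toFinset.filter fun γ => 𝔣 γ = 1) (f := 𝔣)
    (ht := ht) hQ.subset (fun γ hγ => ((hU γ).1 hγ).1) hθ hQ.pos
    (fun γ hγ => hpos γ ((hU γ).1 hγ).1 ((hU γ).1 hγ).2) (fun γ hγ => ((hU γ).1 hγ).2) hθ2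
    ?_ ?_ ?_ ?_ (fun γ hγ => h.theta_add_notMem hN (hQ.subset hγ) (hQ.pos γ hγ))
    (fun γ hγ => h.theta_add_notMem hN ((hU γ).1 hγ).1 (hpos γ ((hU γ).1 hγ).1 ((hU γ).1 hγ).2)) ?_
  · intro γ hγ
    rw [hU]
    by_cases hne : γ = ε 0 + ε 1
    · exact Or.inr (Or.inr hne)
    · rcases h.pairing_theta hN (hQ.subset hγ) (hQ.pos γ hγ) hne with h1 | h1
      · exact Or.inl h1
      · exact Or.inr (Or.inl ⟨hQ.subset hγ, h1⟩)
  · intro γ hγ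
    rw [hU] at hγ ⊢
    exact hσ γ hγ.1 hγ.2
  · intro γ hγ δ hδ hR
    rw [hU] at hγ hδ
    by_contra hne
    have := h.pairing_theta hN hR
      (by rw [map_add]; exact add_pos (hpos γ hγ.1 hγ.2) (hpos δ hδ.1 hδ.2)) hne
    rw [map_add, hγ.2, hδ.2] at this
    norm_num at this
  · intro γ hγ hf δ hδ hR
    rw [hU] at hδ ⊢
    exact ⟨hQ.add_mem γ hγ δ hδ.1 (hpos δ hδ.1 hδ.2) hR, hR, by rw [map_add, hf, hδ.2, zero_add]⟩
  · intro γ hγ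
    rw [hU] at hγ
    obtain ⟨h1, h2⟩ := hσ γ hγ.1 hγ.2
    exact hQ.mem_or_mem γ hγ.1 _ h1 (hpos γ hγ.1 hγ.2) (hpos _ h1 h2) (by rwa [add_sub_cancel])

lemma mem_of_isolated (he : IsRootVectors R e) (hQ : IsNilradical R ht Q)
    (hC : IsCommPol R e (C.filter fun γ => 𝔣 γ = 0) (Q.filter fun γ => 𝔣 γ = 0)) {β : V}
    (hβ : β ∈ Q) (hβf : 𝔣 β = 0)
    (hiso : ∀ γ ∈ R, 𝔣 γ = 0 → 0 < ht γ → β + γ ∉ R) : β ∈ C := by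
  have hsub := hQ.subset
  refine (Finset.mem_filter.1 (hC.mem_of_central he ?_ ?_ (Finset.mem_filter.2 ⟨hβ, hβf⟩)
    (hiso β (hsub hβ) hβf (hQ.pos β hβ)) ?_)).1
  · exact fun γ hγ => hsub (Finset.mem_filter.1 hγ).1
  · intro γ hγ δ hδ h0
    have h1 := add_pos (hQ.pos γ (Finset.mem_filter.1 hγ).1) (hQ.pos δ (Finset.mem_filter.1 hδ).1)
    rw [← map_add, h0, map_zero] at h1
    exact h1.false
  · intro γ hγ
    have h1 := Finset.mem_filter.1 (hC.subset hγ)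
    exact hiso γ (hsub h1.1) h1.2 (hQ.pos γ h1.1)

lemma not_isCommPol_of_alpha_mem [IsAddTorsionFree V] (he : IsRootVectors R e)
    (hQ : IsNilradical R ht Q) (hN : 4 ≤ N) (hα : ε 0 - ε 1 ∈ Q) (hη : ε 2 + ε 3 ∈ Q) :
    ¬ IsCommPol R e C Q := by
  intro hC
  obtain ⟨hC0, hor⟩ := h.reduce he hQ hC (by omega)
    (h.theta_mem_of_eps_add_mem hQ (k := 2) le_rfl (by omega) hη)
  have h1 := h.mem_of_isolated he hQ hC0 hα (h.pairing_theta_alpha (by omega))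
    fun γ hγ hf hp => h.alpha_add_notMem hN hγ hf hp
  have h2 := h.mem_of_isolated he hQ hC0 hη (h.eps_two_add_mem hN).2.1
    fun γ hγ hf hp => h.eps_two_add_add_notMem hN hγ hf hp
  obtain ⟨h3, h4⟩ := h.zero_add_signed_mem (k := 2) ⟨le_rfl, by omega, Or.inr rfl⟩
  rcases hor _ h3 h4 with h5 | h5
  · refine hC.comm _ h2 _ h5 ?_
    convert h.eps_add_eps_mem (i := 0) (j := 3) (by omega) (by omega) using 1
    abel
  · refine hC.comm _ h1 _ h5 ?_
    convert h.eps_add_eps_mem (i := 0) (j := 2) (by omega) (by omega) using 1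
    abel

lemma not_isCommPol_of_eq_four (he : IsRootVectors R e)
    (hQ : IsNilradical R ht Q) (hN : N = 4) (hp : ε 2 + ε 3 ∈ Q) (hm : ε 2 - ε 3 ∈ Q) :
    ¬ IsCommPol R e C Q := by
  intro hC
  obtain ⟨hC0, hor⟩ := h.reduce he hQ hC (by omega)
    (h.theta_mem_of_eps_add_mem hQ (k := 2) le_rfl (by omega) hp)
  have ek := (h.pairing_theta_eps (by omega)).2.2
  have e2 := ek 2 (by omega) (by omega)
  have e3 := ek 3 (by omega) (by omega)
  have hpf : 𝔣 (ε 2 + ε 3) = 0 := by rw [map_add, e2, e3, add_zero]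
  have hmf : 𝔣 (ε 2 - ε 3) = 0 := by rw [map_sub, e2, e3, sub_zero]
  have h1 := h.mem_of_isolated he hQ hC0 hp hpf fun γ hγ hf hpos =>
    h.add_notMem_of_eq_four hN (hQ.subset hp) hpf (hQ.pos _ hp) hγ hf hpos
  have h2 := h.mem_of_isolated he hQ hC0 hm hmf fun γ hγ hf hpos =>
    h.add_notMem_of_eq_four hN (hQ.subset hm) hmf (hQ.pos _ hm) hγ hf hpos
  obtain ⟨h3, h4⟩ := h.zero_add_signed_mem (k := 3) ⟨by omega, by omega, Or.inl rfl⟩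
  rcases hor _ h3 h4 with h5 | h5
  · refine hC.comm _ h2 _ h5 ?_
    convert h.eps_add_eps_mem (i := 0) (j := 2) (by omega) (by omega) using 1
    abel
  · refine hC.comm _ h1 _ h5 ?_
    convert h.eps_add_eps_mem (i := 1) (j := 2) (by omega) (by omega) using 1
    abel

omit h in
lemma not_isCommPol_of_even [IsAddTorsionFree V] (m : ℕ)
    (h : IsTypeDLevel R b ht ε (2 * m + 4)) (he : IsRootVectors R e) (hQ : IsNilradical R ht Q)
    (hp : ε (2 * m + 2) + ε (2 * m + 3) ∈ Q) (hm : ε (2 * m + 2) - ε (2 * m + 3) ∈ Q) :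
    ¬ IsCommPol R e C Q := by
  induction m generalizing R ε Q C with
  | zero => exact h.not_isCommPol_of_eq_four he hQ rfl hp hm
  | succ m ih =>
    intro hC
    obtain ⟨hC0, -⟩ := h.reduce he hQ hC (by omega)
      (h.theta_mem_of_eps_add_mem hQ (k := 2 * (m + 1) + 2) (by omega) (by omega) hp)
    have ek := (h.pairing_theta_eps (by omega)).2.2
    have e2 := ek (2 * m + 2 + 2) (by omega) (by omega)
    have e3 := ek (2 * m + 3 + 2) (by omega) (by omega)
    refine ih (h.shift (by omega)) (he.inter_ker _) (hQ.filter_ker _) ?_ ?_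
      (hC0.mono fun γ hγ => hγ.1)
    · exact Finset.mem_filter.2 ⟨hp, by rw [map_add, e2, e3, add_zero]⟩
    · exact Finset.mem_filter.2 ⟨hm, by rw [map_sub, e2, e3, sub_zero]⟩

end IsTypeDLevel
end TypeD

namespace CascadeSetting

variable {g : Type} [LieRing g] [LieAlgebra ℂ g] [FiniteDimensional ℂ g] (cs : CascadeSetting g)

/-- Linear functionals with prescribed values on the simple roots. -/
lemma exists_linearMap_eq_sum_coeff (c : Dual ℂ cs.H → ℂ) :
    ∃ φ : Dual ℂ cs.H →ₗ[ℂ] ℂ, ∀ γ ∈ cs.Rpos, φ γ = ∑ α ∈ cs.S, cs.coeff γ α * c α := by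
  set B := Basis.extend cs.S_indep
  have hB : ∀ α ∈ cs.S, ∃ i, B i = α := fun α hα =>
    ⟨⟨α, LinearIndepOn.subset_extend _ _ hα⟩, Basis.extend_apply_self _ _⟩
  refine ⟨B.constr ℂ fun i => c (B i), fun γ hγ => ?_⟩
  conv_lhs => rw [cs.coeff_spec γ hγ]
  rw [map_sum]
  refine Finset.sum_congr rfl fun α hα => ?_
  obtain ⟨i, rfl⟩ := hB α hα
  rw [map_nsmul, Basis.constr_basis, nsmul_eq_mul]

lemma coeff_add {γ δ α : Dual ℂ cs.H} (hγ : γ ∈ cs.Rpos) (hδ : δ ∈ cs.Rpos)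
    (hγδ : γ + δ ∈ cs.Rpos) (hα : α ∈ cs.S) :
    cs.coeff (γ + δ) α = cs.coeff γ α + cs.coeff δ α := by
  obtain ⟨φ, hφ⟩ := cs.exists_linearMap_eq_sum_coeff fun β => if β = α then 1 else 0
  have hφ' : ∀ ρ ∈ cs.Rpos, φ ρ = cs.coeff ρ α := fun ρ hρ => by simp [hφ ρ hρ, hα]
  have := map_add φ γ δ
  rw [hφ' _ hγδ, hφ' _ hγ, hφ' _ hδ] at this
  exact_mod_cast this

lemma exists_height :
    ∃ ht : Dual ℂ cs.H →+ ℝ, ∀ γ ∈ cs.R, ht γ ≠ 0 ∧ (0 < ht γ ↔ γ ∈ cs.Rpos) := by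
  obtain ⟨φ, hφ⟩ := cs.exists_linearMap_eq_sum_coeff fun _ => 1
  have hpos : ∀ γ ∈ cs.Rpos, 0 < (φ γ).re := by
    intro γ hγ
    have h1 : φ γ = ((∑ α ∈ cs.S, cs.coeff γ α : ℕ) : ℂ) := by simp [hφ γ hγ]
    rw [h1, Complex.natCast_re, Nat.cast_pos, Nat.pos_iff_ne_zero]
    intro h0
    refine ((cs.mem_R_iff γ).1 (cs.Rpos_subset hγ)).1 ?_
    rw [cs.coeff_spec γ hγ]
    exact Finset.sum_eq_zero fun α hα => by rw [Finset.sum_eq_zero_iff.1 h0 α hα, zero_smul]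
  refine ⟨Complex.reAddGroupHom.comp φ.toAddMonoidHom, fun γ hγ => ?_⟩
  change (φ γ).re ≠ 0 ∧ (0 < (φ γ).re ↔ _)
  by_cases h : γ ∈ cs.Rpos
  · exact ⟨(hpos γ h).ne', iff_of_true (hpos γ h) h⟩
  · have := hpos _ ((cs.mem_Rpos_or γ hγ).resolve_left h)
    rw [map_neg, Complex.neg_re] at this
    exact ⟨by linarith, iff_of_false (by linarith) h⟩

lemma isNilradical_nRoots {T : Finset (Dual ℂ cs.H)} (hT : T ⊆ cs.S) {ht : Dual ℂ cs.H →+ ℝ}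
    (hht : ∀ γ ∈ cs.R, 0 < ht γ ↔ γ ∈ cs.Rpos) :
    IsNilradical (cs.R : Set (Dual ℂ cs.H)) ht (cs.nRoots T) := by
  have hmem : ∀ γ, γ ∈ cs.nRoots T ↔ γ ∈ cs.Rpos ∧ ∃ α ∈ T, cs.coeff γ α ≠ 0 :=
    fun γ => Finset.mem_filter
  have hadd : ∀ γ ∈ cs.Rpos, ∀ δ ∈ cs.Rpos, γ + δ ∈ cs.R → γ + δ ∈ cs.Rpos := by
    intro γ hγ δ hδ hR
    rw [← hht _ hR, map_add]
    exact add_pos ((hht _ (cs.Rpos_subset hγ)).2 hγ) ((hht _ (cs.Rpos_subset hδ)).2 hδ)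
  refine ⟨cs.coe_nRoots_subset T, fun γ hγ => ?_, fun γ hγ δ hδ hp hR => ?_,
    fun γ hγ δ hδ hpγ hpδ hm => ?_⟩
  · exact (hht γ (cs.coe_nRoots_subset T hγ)).2 ((hmem γ).1 hγ).1
  · obtain ⟨hγ, α, hα, hne⟩ := (hmem γ).1 hγ
    have hδ := (hht δ hδ).1 hp
    have hR := hadd γ hγ δ hδ hR
    refine (hmem _).2 ⟨hR, α, hα, ?_⟩
    rw [cs.coeff_add hγ hδ hR (hT hα)]
    omega
  · obtain ⟨hR, α, hα, hne⟩ := (hmem _).1 hm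
    have hγ := (hht γ hγ).1 hpγ
    have hδ := (hht δ hδ).1 hpδ
    rw [cs.coeff_add hγ hδ hR (hT hα)] at hne
    rw [hmem, hmem]
    by_cases h0 : cs.coeff γ α = 0
    · exact Or.inr ⟨hδ, α, hα, by omega⟩
    · exact Or.inl ⟨hγ, α, hα, h0⟩

end CascadeSetting

namespace TypeDSetting

variable {g : Type} [LieRing g] [LieAlgebra ℂ g] [FiniteDimensional ℂ g] {n : ℕ}
  (ds : TypeDSetting g n)

/-- The functionals `ε_i`, indexed by natural numbers. -/
def epsNat (i : ℕ) : Dual ℂ ds.H := if h : i < n then ds.eps ⟨i, h⟩ else 0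

lemma epsNat_of_lt {i : ℕ} (h : i < n) : ds.epsNat i = ds.eps ⟨i, h⟩ := dif_pos h

lemma dRoots_epsNat : dRoots ds.epsNat n = (ds.Rpos : Set (Dual ℂ ds.H)) := by
  ext γ
  simp only [ds.Rpos_eq, Finset.coe_union, Finset.coe_image, Finset.coe_filter, Finset.mem_univ,
    true_and, Set.mem_union, Set.mem_image, Set.mem_ofPred_eq, Prod.exists, dRoots]
  constructor
  · rintro ⟨i, j, hij, hj, rfl | rfl⟩
    · right
      exact ⟨⟨i, hij.trans hj⟩, ⟨j, hj⟩, hij, by rw [epsNat_of_lt, epsNat_of_lt]⟩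
    · left
      exact ⟨⟨i, hij.trans hj⟩, ⟨j, hj⟩, hij, by rw [epsNat_of_lt, epsNat_of_lt]⟩
  · rintro (⟨i, j, hij, rfl⟩ | ⟨i, j, hij, rfl⟩)
    · exact ⟨i, j, hij, j.2, Or.inr (by rw [ds.epsNat_of_lt i.2, ds.epsNat_of_lt j.2])⟩
    · exact ⟨i, j, hij, j.2, Or.inl (by rw [ds.epsNat_of_lt i.2, ds.epsNat_of_lt j.2])⟩

lemma epsNat_inj {i j : ℕ} (hi : i < n) (hj : j < n) (h : ds.epsNat i = ds.epsNat j) : i = j := by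
  rw [ds.epsNat_of_lt hi, ds.epsNat_of_lt hj] at h
  by_contra hne
  have h1 := ds.ip_eps ⟨i, hi⟩ ⟨i, hi⟩
  have h2 := ds.ip_eps ⟨i, hi⟩ ⟨j, hj⟩
  rw [← h, h1, if_pos rfl, if_neg (by simpa using hne)] at h2
  exact one_ne_zero h2

lemma isTypeDLevel {b : Dual ℂ ds.H → Dual ℂ ds.H → ℝ}
    (hb : IsRootForm (ds.R : Set (Dual ℂ ds.H)) b) {ht : Dual ℂ ds.H →+ ℝ}
    (hht : ∀ γ ∈ ds.R, ht γ ≠ 0 ∧ (0 < ht γ ↔ γ ∈ ds.Rpos)) :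
    IsTypeDLevel (ds.R : Set (Dual ℂ ds.H)) b ht ds.epsNat n where
  form := hb
  finite := ds.R.finite_toSet
  inj i hi j hj := ds.epsNat_inj hi hj
  dRoots_subset := by
    rw [dRoots_epsNat]
    exact ds.Rpos_subset
  ht_pos γ hγ := by
    rw [dRoots_epsNat] at hγ
    exact (hht γ (ds.Rpos_subset hγ)).2.2 hγ
  ht_ne γ hγ := (hht γ hγ).1
  sum γ hγ δ hδ hpγ hpδ hR := by
    rw [dRoots_epsNat]
    exact ⟨(hht γ hγ).2.1 hpγ, (hht δ hδ).2.1 hpδ,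
      (hht _ hR).2.1 (by rw [map_add]; exact add_pos hpγ hpδ)⟩

lemma not_hasCP_of_alpha_mem {T : Finset (Dual ℂ ds.H)} (hT : T ⊆ ds.S)
    (hα : ds.epsNat 0 - ds.epsNat 1 ∈ ds.nRoots T)
    (hη : ds.epsNat 2 + ds.epsNat 3 ∈ ds.nRoots T) : ¬ HasCP ℂ (ds.nT T) := by
  intro hCP
  obtain ⟨⟨b, hb⟩, he, -⟩ := ds.exists_rootForm_rootVectors
  obtain ⟨ht, hht⟩ := ds.exists_height
  obtain ⟨C, hC⟩ := ds.exists_isCommPol_of_hasCP hT hCP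
  have : IsAddTorsionFree (Dual ℂ ds.H) := .of_isTorsionFree ℂ _
  exact (ds.isTypeDLevel hb hht).not_isCommPol_of_alpha_mem he
    (ds.isNilradical_nRoots hT fun γ hγ => (hht γ hγ).2) ds.four_le hα hη hC

lemma not_hasCP_of_even {m : ℕ} (hn : n = 2 * m + 4) {T : Finset (Dual ℂ ds.H)} (hT : T ⊆ ds.S)
    (hp : ds.epsNat (2 * m + 2) + ds.epsNat (2 * m + 3) ∈ ds.nRoots T)
    (hm : ds.epsNat (2 * m + 2) - ds.epsNat (2 * m + 3) ∈ ds.nRoots T) :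
    ¬ HasCP ℂ (ds.nT T) := by
  subst hn
  intro hCP
  obtain ⟨⟨b, hb⟩, he, -⟩ := ds.exists_rootForm_rootVectors
  obtain ⟨ht, hht⟩ := ds.exists_height
  obtain ⟨C, hC⟩ := ds.exists_isCommPol_of_hasCP hT hCP
  have : IsAddTorsionFree (Dual ℂ ds.H) := .of_isTorsionFree ℂ _
  exact (ds.isTypeDLevel hb hht).not_isCommPol_of_even m he
    (ds.isNilradical_nRoots hT fun γ hγ => (hht γ hγ).2) hp hm hC

end TypeDSetting

/-- **Proposition 4.7 (Panyushev).** Let `g` be of type `D_n`, `n ≥ 4`, and `n` an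
optimal nilradical. (1) If both `β₂ = ε₁ − ε₂` and `β₃ = ε₃ + ε₄` lie in `K(n)`, then
`n` has no commutative polarisation. (2) If `g` is of type `D_{2m}` and both
`β_{2m−1} = ε_{2m−1} + ε_{2m}` and `β_{2m} = ε_{2m−1} − ε_{2m}` lie in `K(n)`, then
`n` has no commutative polarisation. -/
theorem typeD_no_CP :
    (∀ (g : Type) [LieRing g] [LieAlgebra ℂ g] [FiniteDimensional ℂ g]
        (n : ℕ) (ds : TypeDSetting g n)
        (T : Finset (Module.Dual ℂ ds.toCascadeSetting.H)),
        T ⊆ ds.toCascadeSetting.S →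
        T = ds.toCascadeSetting.optT T →
        (ds.eps ⟨0, by have := ds.four_le; omega⟩ -
            ds.eps ⟨1, by have := ds.four_le; omega⟩) ∈ ds.toCascadeSetting.KT T →
        (ds.eps ⟨2, by have := ds.four_le; omega⟩ +
            ds.eps ⟨3, by have := ds.four_le; omega⟩) ∈ ds.toCascadeSetting.KT T →
        ¬ HasCP ℂ ↥(ds.toCascadeSetting.nT T)) ∧
    (∀ (g : Type) [LieRing g] [LieAlgebra ℂ g] [FiniteDimensional ℂ g]
        (m : ℕ) (ds : TypeDSetting g (2 * m))
        (T : Finset (Module.Dual ℂ ds.toCascadeSetting.H)),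
        T ⊆ ds.toCascadeSetting.S →
        T = ds.toCascadeSetting.optT T →
        (ds.eps ⟨2 * m - 2, by have := ds.four_le; omega⟩ +
            ds.eps ⟨2 * m - 1, by have := ds.four_le; omega⟩) ∈
              ds.toCascadeSetting.KT T →
        (ds.eps ⟨2 * m - 2, by have := ds.four_le; omega⟩ -
            ds.eps ⟨2 * m - 1, by have := ds.four_le; omega⟩) ∈
              ds.toCascadeSetting.KT T →
        ¬ HasCP ℂ ↥(ds.toCascadeSetting.nT T)) := by
  constructor
  · intro g _ _ _ n ds T hT _ hα hη
    have hn := ds.four_le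
    refine ds.not_hasCP_of_alpha_mem hT ?_ ?_
    · rw [ds.epsNat_of_lt (by omega), ds.epsNat_of_lt (by omega)]
      exact (Finset.mem_filter.1 hα).2
    · rw [ds.epsNat_of_lt (by omega), ds.epsNat_of_lt (by omega)]
      exact (Finset.mem_filter.1 hη).2
  · intro g _ _ _ m ds T hT _ hp hm
    obtain ⟨k, rfl⟩ : ∃ k, m = k + 2 := ⟨m - 2, by have := ds.four_le; omega⟩
    refine ds.not_hasCP_of_even (m := k) (by omega) hT ?_ ?_
    · rw [ds.epsNat_of_lt (by omega), ds.epsNat_of_lt (by omega)]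
      exact (Finset.mem_filter.1 hp).2
    · rw [ds.epsNat_of_lt (by omega), ds.epsNat_of_lt (by omega)]
      exact (Finset.mem_filter.1 hm).2
end
end

section
/- Let q be a finite-dimensional complex Lie algebra. (i) If q' ⊆ q is a Lie subalgebra with b(q') = b(q), then the algebra of symmetric invariants S(q)^q is contained in S(q'). (ii) In particular, if a ⊆ q is a commutative polarisation, then S(q)^q ⊆ S(a). (iii) Moreover, if a_1, …, a_k are commutative polarisations of q, then S(q)^q ⊆ S(a_1 ∩ … ∩ a_k). -/
noncomputable section

open Module

/-- `(A, ι)` is a symmetric algebra of the `ℂ`-vector space `q`: a commutative algebra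
together with a linear map `ι : q → A` satisfying the universal property. -/
def IsSymmAlg {q A : Type} [AddCommGroup q] [Module ℂ q] [CommRing A] [Algebra ℂ A]
    (ι : q →ₗ[ℂ] A) : Prop :=
  ∀ (B : Type) [CommRing B] [Algebra ℂ B], ∀ f : q →ₗ[ℂ] B,
    ∃! F : A →ₐ[ℂ] B, ∀ x, F (ι x) = f x

/-- The symmetric invariants `S(q)^q ⊆ S(q) = A`: the elements annihilated by the
(unique) derivations of `A` extending the adjoint operators `ad x`, `x ∈ q`. -/
def symmInvariants {q A : Type} [LieRing q] [LieAlgebra ℂ q] [CommRing A] [Algebra ℂ A]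
    (ι : q →ₗ[ℂ] A) : Set A :=
  {p | ∀ (x : q) (D : Derivation ℂ A A), (∀ y, D (ι y) = ι ⁅x, y⁆) → D p = 0}

open MvPolynomial in
/-- In characteristic zero, a polynomial whose partial derivatives outside of `s` vanish
only involves the variables in `s`. -/
theorem mem_supported_of_pderiv_eq_zero {σ : Type*} (s : Set σ) (p : MvPolynomial σ ℂ)
    (h : ∀ i ∉ s, pderiv i p = 0) : p ∈ supported ℂ s := by
  classical
  rw [mem_supported]
  intro i hi
  by_contra his
  obtain ⟨m, hm, him⟩ := (mem_vars_iff_mem_support i).1 hi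
  have hle : Finsupp.single i 1 ≤ m := by
    rw [Finsupp.single_le_iff]
    exact Nat.one_le_iff_ne_zero.2 (Finsupp.mem_support_iff.1 him)
  have h0 := coeff_pderiv (i := i) p (m - Finsupp.single i 1)
  rw [h i his, tsub_add_cancel_of_le hle, coeff_zero, eq_comm, mul_eq_zero] at h0
  rcases h0 with h0 | h0
  · exact mem_support_iff.1 hm h0
  · exact Nat.cast_add_one_ne_zero _ h0

open MvPolynomial in
/-- A derivation of a polynomial ring is determined by its values on the variables. -/
theorem derivation_eq_sum_pderiv {σ : Type*} [Fintype σ]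
    (D : Derivation ℂ (MvPolynomial σ ℂ) (MvPolynomial σ ℂ)) (p : MvPolynomial σ ℂ) :
    D p = ∑ i, pderiv i p * D (X i) := by
  classical
  have hsum (r : MvPolynomial σ ℂ) :
      (∑ i, D (X i) • pderiv i) r = ∑ i, (D (X i) • pderiv i) r := by
    rw [← Derivation.coeFnAddMonoidHom_apply, map_sum, Finset.sum_apply]
    rfl
  have h : D = ∑ i, D (X i) • pderiv i := by
    refine derivation_ext fun j => ?_
    rw [hsum]
    simp [pderiv_X, Pi.single_apply]
  conv_lhs => rw [h, hsum]
  simp [mul_comm]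

/-- The form `(x, y) ↦ ξ ⁅x, y⁆`, viewed as a linear map in all its arguments. -/
def kirillovForm (L : Type) [LieRing L] [LieAlgebra ℂ L] :
    Dual ℂ L →ₗ[ℂ] L →ₗ[ℂ] Dual ℂ L :=
  LinearMap.mk₂ ℂ (fun ξ x => ξ ∘ₗ (LieAlgebra.ad ℂ L x : L →ₗ[ℂ] L))
    (fun _ _ _ => LinearMap.add_comp _ _ _)
    (fun _ _ _ => LinearMap.smul_comp _ _ _) (fun _ _ _ => by ext; simp)
    (fun _ _ _ => by ext; simp)

theorem coadjointStab_eq_ker {L : Type} [LieRing L] [LieAlgebra ℂ L] (ξ : Dual ℂ L) :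
    coadjointStab ℂ L ξ = LinearMap.ker (kirillovForm L ξ) := by
  ext x
  exact ⟨fun h => LinearMap.ext h, fun h => LinearMap.congr_fun (g := 0) h⟩

theorem lieIndex_le {L : Type} [LieRing L] [LieAlgebra ℂ L] (ξ : Dual ℂ L) :
    lieIndex ℂ L ≤ finrank ℂ (coadjointStab ℂ L ξ) :=
  Nat.sInf_le ⟨ξ, rfl⟩

theorem exists_finrank_coadjointStab_eq_lieIndex (L : Type) [LieRing L] [LieAlgebra ℂ L] :
    ∃ ξ : Dual ℂ L, finrank ℂ (coadjointStab ℂ L ξ) = lieIndex ℂ L := by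
  obtain ⟨ξ, hξ⟩ := Nat.sInf_mem
    (s := {n | ∃ ξ : Dual ℂ L, n = finrank ℂ (coadjointStab ℂ L ξ)}) ⟨_, 0, rfl⟩
  exact ⟨ξ, hξ.symm⟩

open MvPolynomial in
/-- The stabilisers of minimal dimension are the generic ones: they occur off the zero locus of a
nonzero polynomial. -/
theorem exists_polynomial_finrank_coadjointStab {q I : Type} [LieRing q] [LieAlgebra ℂ q]
    [FiniteDimensional ℂ q] [Fintype I] (b : Basis I ℂ q) :
    ∃ d : MvPolynomial I ℂ, d ≠ 0 ∧ ∀ ξ : Dual ℂ q, eval (fun i => ξ (b i)) d ≠ 0 →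
      finrank ℂ (coadjointStab ℂ q ξ) = lieIndex ℂ q := by
  classical
  obtain ⟨ξ₀, hξ₀⟩ := exists_finrank_coadjointStab_eq_lieIndex q
  obtain ⟨W, hW⟩ := Submodule.exists_isCompl (coadjointStab ℂ q ξ₀)
  obtain ⟨g, hg⟩ := LinearMap.exists_leftInverse_of_injective
    ((kirillovForm q ξ₀).domRestrict W) (by
      rw [LinearMap.ker_domRestrict, ← coadjointStab_eq_ker, ← Submodule.disjoint_iff_comap_eq_bot]
      exact hW.symm.disjoint)
  let w := finBasis ℂ W
  let T (ξ : Dual ℂ q) : W →ₗ[ℂ] W := g ∘ₗ (kirillovForm q ξ).domRestrict W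
  let N : Matrix (Fin (finrank ℂ W)) (Fin (finrank ℂ W)) (MvPolynomial I ℂ) :=
    fun i j => ∑ k, C (w.coord i (T (b.coord k) (w j))) * X k
  have hN (ξ : Dual ℂ q) : eval (fun i => ξ (b i)) N.det = LinearMap.det (T ξ) := by
    rw [RingHom.map_det, ← LinearMap.det_toMatrix w]
    congr 1
    ext i j
    have hξ : ξ = ∑ k, ξ (b k) • b.coord k := (b.sum_dual_apply_smul_coord ξ).symm
    conv_rhs => rw [hξ]
    rw [RingHom.mapMatrix_apply, Matrix.map_apply]
    simp [N, T, LinearMap.toMatrix_apply, mul_comm, -Basis.sum_dual_apply_smul_coord]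
  refine ⟨N.det, fun h => ?_, fun ξ hξ => ?_⟩
  · have h1 := hN ξ₀
    rw [h, show T ξ₀ = LinearMap.id from hg] at h1
    simp at h1
  · rw [hN] at hξ
    refine le_antisymm ?_ (lieIndex_le ξ)
    have hdisj : Disjoint (coadjointStab ℂ q ξ) W := by
      rw [Submodule.disjoint_def]
      intro x hx hxW
      have hker : (⟨x, hxW⟩ : W) ∈ LinearMap.ker (T ξ) := by
        rw [coadjointStab_eq_ker, LinearMap.mem_ker] at hx
        simp [T, hx]
      by_contra hx0
      refine hξ (LinearMap.det_eq_zero_iff_ker_ne_bot.2 fun hbot => hx0 ?_)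
      rw [hbot, Submodule.mem_bot] at hker
      exact congrArg Subtype.val hker
    have h1 := Submodule.finrank_add_finrank_le_of_disjoint hdisj
    have h2 := Submodule.finrank_add_eq_of_isCompl hW
    omega

/-- If `b(q') = b(q)`, then `q'` contains every coadjoint stabiliser of minimal dimension. -/
theorem coadjointStab_le_of_bHalf_eq {q : Type} [LieRing q] [LieAlgebra ℂ q]
    [FiniteDimensional ℂ q] (q' : LieSubalgebra ℂ q) (hb : bHalf ℂ ↥q' = bHalf ℂ q)
    (ξ : Dual ℂ q) (hξ : finrank ℂ (coadjointStab ℂ q ξ) = lieIndex ℂ q) :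
    coadjointStab ℂ q ξ ≤ q'.toSubmodule := by
  let S : Submodule ℂ q' := coadjointStab ℂ q' (ξ ∘ₗ q'.toSubmodule.subtype)
  let f : S →ₗ[ℂ] Dual ℂ q := kirillovForm q ξ ∘ₗ q'.toSubmodule.subtype ∘ₗ S.subtype
  have hrange : finrank ℂ (LinearMap.range f) ≤
      finrank ℂ (q'.toSubmodule.dualAnnihilator) := by
    refine Submodule.finrank_mono ?_
    rintro _ ⟨x, rfl⟩
    rw [Submodule.mem_dualAnnihilator]
    exact fun y hy => x.2 ⟨y, hy⟩
  have hker : finrank ℂ (LinearMap.ker f) ≤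
      finrank ℂ ↥(q'.toSubmodule ⊓ coadjointStab ℂ q ξ) := by
    refine LinearMap.finrank_le_finrank_of_injective
      (f := ((q'.toSubmodule.subtype ∘ₗ S.subtype) ∘ₗ (LinearMap.ker f).subtype).codRestrict
        (q'.toSubmodule ⊓ coadjointStab ℂ q ξ) ?_) ?_
    · intro x
      refine ⟨x.1.1.2, ?_⟩
      rw [coadjointStab_eq_ker]
      exact x.2
    · intro x y hxy
      exact Subtype.ext (Subtype.ext (Subtype.ext (Subtype.mk.inj hxy)))
  have hrn := f.finrank_range_add_finrank_ker
  have hann := Subspace.finrank_add_finrank_dualAnnihilator_eq q'.toSubmodule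
  have hind : lieIndex ℂ q' ≤ finrank ℂ S := lieIndex_le _
  have hb' : finrank ℂ q' + lieIndex ℂ q' = finrank ℂ q + lieIndex ℂ q := by
    unfold bHalf at hb
    exact_mod_cast (div_left_inj' (two_ne_zero (α := ℚ))).1 hb
  have hdim : finrank ℂ q'.toSubmodule = finrank ℂ q' := rfl
  have heq : q'.toSubmodule ⊓ coadjointStab ℂ q ξ = coadjointStab ℂ q ξ :=
    Submodule.eq_of_le_of_finrank_le inf_le_right (by omega)
  exact inf_eq_right.1 heq

/-- For an abelian Lie algebra, `b(a) = dim a`. -/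
theorem bHalf_eq_finrank_of_isLieAbelian (L : Type) [LieRing L] [LieAlgebra ℂ L]
    [IsLieAbelian L] : bHalf ℂ L = finrank ℂ L := by
  obtain ⟨ξ, hξ⟩ := exists_finrank_coadjointStab_eq_lieIndex L
  have htop : coadjointStab ℂ L ξ = ⊤ := by
    rw [eq_top_iff]
    intro x _ y
    rw [trivial_lie_zero, map_zero]
  rw [htop, finrank_top] at hξ
  rw [bHalf, ← hξ]
  ring

/-- A basis turns a symmetric algebra into a polynomial algebra. -/
theorem IsSymmAlg.exists_algEquiv {q A I : Type} [AddCommGroup q] [Module ℂ q] [CommRing A]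
    [Algebra ℂ A] {ι : q →ₗ[ℂ] A} (hA : IsSymmAlg ι) (b : Basis I ℂ q) :
    ∃ e : A ≃ₐ[ℂ] MvPolynomial I ℂ, ∀ i, e (ι (b i)) = MvPolynomial.X i := by
  obtain ⟨F, hF, -⟩ := hA (MvPolynomial I ℂ) (b.constr ℂ MvPolynomial.X)
  have hFb (i : I) : F (ι (b i)) = MvPolynomial.X i := by rw [hF, b.constr_basis]
  let G : MvPolynomial I ℂ →ₐ[ℂ] A := MvPolynomial.aeval fun i => ι (b i)
  have hGF (x : q) : G (F (ι x)) = ι x := by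
    refine LinearMap.congr_fun (f := G.toLinearMap ∘ₗ F.toLinearMap ∘ₗ ι) (b.ext fun i => ?_) x
    simp [hFb, G]
  refine ⟨AlgEquiv.ofAlgHom F G ?_ ?_, hFb⟩
  · ext i : 1
    simp [G, hFb]
  · exact (hA A ι).unique (y₁ := G.comp F) (y₂ := AlgHom.id ℂ A) hGF fun _ => rfl

open MvPolynomial in
/-- The differential at `ξ` of a symmetric invariant lies in the stabiliser of `ξ`. -/
theorem sum_eval_pderiv_smul_mem_coadjointStab {q A I : Type} [LieRing q] [LieAlgebra ℂ q]
    [CommRing A] [Algebra ℂ A] [Fintype I] {ι : q →ₗ[ℂ] A} (b : Basis I ℂ q)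
    (e : A ≃ₐ[ℂ] MvPolynomial I ℂ) (he : ∀ i, e (ι (b i)) = X i) {p : A}
    (hp : p ∈ symmInvariants ι) (ξ : Dual ℂ q) :
    ∑ i, eval (fun j => ξ (b j)) (pderiv i (e p)) • b i ∈ coadjointStab ℂ q ξ := by
  intro x
  let D : Derivation ℂ (MvPolynomial I ℂ) (MvPolynomial I ℂ) :=
    mkDerivation ℂ fun i => e (ι ⁅x, b i⁆)
  let D' : Derivation ℂ A A :=
    Derivation.mk' (e.symm.toLinearMap ∘ₗ D.toLinearMap ∘ₗ e.toLinearMap)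
      (fun u v => by simp [Derivation.leibniz])
  have hD' : D' p = 0 := by
    refine hp x D' fun y => ?_
    refine LinearMap.congr_fun (f := D'.toLinearMap ∘ₗ ι)
      (g := ι ∘ₗ (LieAlgebra.ad ℂ q x : q →ₗ[ℂ] q)) (b.ext fun i => ?_) y
    change e.symm (D (e (ι (b i)))) = ι ⁅x, b i⁆
    rw [he, mkDerivation_X, e.symm_apply_apply]
  have hD : D (e p) = 0 := e.symm.injective (hD'.trans (map_zero _).symm)
  have heval (y : q) : eval (fun j => ξ (b j)) (e (ι y)) = ξ y := by
    refine LinearMap.congr_fun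
      (f := (aeval fun j => ξ (b j)).toLinearMap ∘ₗ e.toLinearMap ∘ₗ ι) (b.ext fun i => ?_) y
    simp [he]
  have h := congrArg (eval fun j => ξ (b j)) hD
  rw [derivation_eq_sum_pderiv] at h
  simp only [D, mkDerivation_X, map_sum, map_mul, heval, map_zero] at h
  rw [← lie_skew, map_neg, lie_sum, map_sum, neg_eq_zero]
  simpa using h

open MvPolynomial in
/-- If a subspace `V` contains every coadjoint stabiliser of minimal dimension, then
`S(q)^q ⊆ S(V)`. -/
theorem symmInvariants_subset_adjoin {q A : Type} [LieRing q] [LieAlgebra ℂ q]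
    [FiniteDimensional ℂ q] [CommRing A] [Algebra ℂ A] {ι : q →ₗ[ℂ] A} (hA : IsSymmAlg ι)
    (V : Submodule ℂ q)
    (hV : ∀ ξ : Dual ℂ q, finrank ℂ (coadjointStab ℂ q ξ) = lieIndex ℂ q →
      coadjointStab ℂ q ξ ≤ V) :
    symmInvariants ι ⊆ (Algebra.adjoin ℂ (ι '' (V : Set q)) : Subalgebra ℂ A) := by
  intro p hp
  obtain ⟨W, hVW⟩ := Submodule.exists_isCompl V
  let b := ((finBasis ℂ V).prod (finBasis ℂ W)).map (V.prodEquivOfIsCompl W hVW)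
  have hbl (i) : b (Sum.inl i) ∈ V := by simp [b]
  have hbr (i) (x : q) (hx : x ∈ V) : b.repr x (Sum.inr i) = 0 := by
    have h : (V.prodEquivOfIsCompl W hVW).symm x = (⟨x, hx⟩, 0) :=
      Submodule.prodEquivOfIsCompl_symm_apply_left V W hVW ⟨x, hx⟩
    simp [b, h]
  obtain ⟨e, he⟩ := hA.exists_algEquiv b
  obtain ⟨d, hd0, hd⟩ := exists_polynomial_finrank_coadjointStab b
  have hpd (i) : pderiv (Sum.inr i) (e p) = 0 := by
    refine (mul_eq_zero.1 (MvPolynomial.funext fun v => ?_)).resolve_left hd0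
    obtain ⟨ξ, rfl⟩ : ∃ ξ : Dual ℂ q, (fun j => ξ (b j)) = v :=
      ⟨b.constr ℂ v, _root_.funext fun j => b.constr_basis ℂ v j⟩
    rw [map_mul, map_zero]
    by_cases hv : eval (fun j => ξ (b j)) d = 0
    · rw [hv, zero_mul]
    · have h := hbr i _ (hV ξ (hd ξ hv) (sum_eval_pderiv_smul_mem_coadjointStab b e he hp ξ))
      rw [b.repr_sum_self] at h
      rw [h, mul_zero]
  have hsupp : e p ∈ supported ℂ (Set.range Sum.inl) := by
    refine mem_supported_of_pderiv_eq_zero _ _ fun i hi => ?_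
    rcases i with i | i
    · exact absurd ⟨i, rfl⟩ hi
    · exact hpd i
  have hmap : p ∈ (supported ℂ (Set.range Sum.inl)).map e.symm.toAlgHom :=
    ⟨e p, hsupp, e.symm_apply_apply p⟩
  rw [supported_eq_adjoin_X, AlgHom.map_adjoin] at hmap
  refine Algebra.adjoin_mono ?_ hmap
  rintro _ ⟨_, ⟨_, ⟨i, rfl⟩, rfl⟩, rfl⟩
  exact ⟨b (Sum.inl i), hbl i, (e.symm_apply_eq.2 (he _).symm).symm⟩

/-- **Proposition 5.5 (Panyushev).** (i) If `q' ⊆ q` is a subalgebra with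
`b(q') = b(q)`, then `S(q)^q ⊆ S(q')`. (ii) In particular this holds when `q'` is a
commutative polarisation of `q`. (iii) Moreover, if `a_1, …, a_k` are commutative
polarisations of `q`, then `S(q)^q ⊆ S(a_1 ∩ ⋯ ∩ a_k)`. -/
theorem symmetric_invariants_subset_of_bHalf_eq
    {q A : Type} [LieRing q] [LieAlgebra ℂ q] [FiniteDimensional ℂ q]
    [CommRing A] [Algebra ℂ A] (ι : q →ₗ[ℂ] A) (hA : IsSymmAlg ι) :
    -- (i)
    (∀ q' : LieSubalgebra ℂ q, bHalf ℂ ↥q' = bHalf ℂ q →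
      symmInvariants ι ⊆ (Algebra.adjoin ℂ (ι '' (q' : Set q)) : Subalgebra ℂ A)) ∧
    -- (ii)
    (∀ a : LieSubalgebra ℂ q, IsLieAbelian a →
      (Module.finrank ℂ ↥a : ℚ) = bHalf ℂ q →
      symmInvariants ι ⊆ (Algebra.adjoin ℂ (ι '' (a : Set q)) : Subalgebra ℂ A)) ∧
    -- (iii)
    (∀ (k : ℕ) (a : Fin k → LieSubalgebra ℂ q),
      (∀ i, IsLieAbelian (a i) ∧ (Module.finrank ℂ ↥(a i) : ℚ) = bHalf ℂ q) →
      symmInvariants ι ⊆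
        (Algebra.adjoin ℂ (ι '' (⋂ i, ((a i : Set q)))) : Subalgebra ℂ A)) := by
  have hab (a : LieSubalgebra ℂ q) (ha : IsLieAbelian a)
      (hdim : (Module.finrank ℂ ↥a : ℚ) = bHalf ℂ q) : bHalf ℂ ↥a = bHalf ℂ q :=
    (bHalf_eq_finrank_of_isLieAbelian a).trans hdim
  have hsub (q' : LieSubalgebra ℂ q) (hq' : bHalf ℂ ↥q' = bHalf ℂ q) :
      symmInvariants ι ⊆ (Algebra.adjoin ℂ (ι '' (q' : Set q)) : Subalgebra ℂ A) :=
    symmInvariants_subset_adjoin hA q'.toSubmodule (coadjointStab_le_of_bHalf_eq q' hq')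
  refine ⟨hsub, fun a ha hdim => hsub a (hab a ha hdim), fun k a h => ?_⟩
  have := symmInvariants_subset_adjoin hA (⨅ i, (a i).toSubmodule) fun ξ hξ =>
    le_iInf fun i => coadjointStab_le_of_bHalf_eq (a i) (hab (a i) (h i).1 (h i).2) ξ hξ
  rwa [Submodule.coe_iInf] at this
end
end
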